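/- Let H be a minimal counterexample to the main theorem: a plane graph with Δ(H)=6, containing no subgraph isomorphic to a diamond or a house, in which every 6-vertex either is not incident with two 4-cycles sharing an edge or is not incident with three cycles of sizes p,q,ℓ for any {p,q,ℓ} ∈ {{3,4,4},{3,3,4}}, that is not totally 7-colorable, and that minimizes |V(H)|+|E(H)| among all such graphs. Then for every edge uv of H with d_H(u) ≤ 3 or d_H(v) ≤ 3, one has d_H(u) + d_H(v) ≥ 8. -/

import Mathlib

open SimpleGraph

/-- The degree of a vertex, as `Nat.card` of its neighbor set. -/
noncomputable def vdeg {V : Type*} (G : SimpleGraph V) (v : V) : ℕ :=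
  Nat.card (G.neighborSet v)

/-- `G` has maximum degree exactly `k`. -/
def MaxDegreeEq {V : Type*} (G : SimpleGraph V) (k : ℕ) : Prop :=
  (∀ v, vdeg G v ≤ k) ∧ ∃ v, vdeg G v = k

/-- `G` admits a total `k`-coloring: a coloring of vertices and edges with `k` colors such
that adjacent vertices get distinct colors, edges sharing an endpoint get distinct colors,
and each edge gets a color distinct from those of its endpoints. -/
def TotallyColorable {V : Type*} (G : SimpleGraph V) (k : ℕ) : Prop :=
  ∃ (cv : V → Fin k) (ce : Sym2 V → Fin k),
    (∀ ⦃u v⦄, G.Adj u v → cv u ≠ cv v) ∧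
    (∀ e₁ ∈ G.edgeSet, ∀ e₂ ∈ G.edgeSet, e₁ ≠ e₂ → (∃ x, x ∈ e₁ ∧ x ∈ e₂) →
      ce e₁ ≠ ce e₂) ∧
    (∀ ⦃u v⦄, G.Adj u v → ce s(u, v) ≠ cv u)

/-- The diamond: `K₄` minus one edge. -/
def diamondGraph : SimpleGraph (Fin 4) :=
  SimpleGraph.fromEdgeSet {s(0, 1), s(0, 2), s(0, 3), s(1, 2), s(1, 3)}

/-- The house: a `4`-cycle `1 2 3 4` and a triangle `0 1 4` sharing exactly the edge `{1,4}`
(equivalently, a `5`-cycle plus one chord). -/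
def houseGraph : SimpleGraph (Fin 5) :=
  SimpleGraph.fromEdgeSet {s(0, 1), s(1, 2), s(2, 3), s(3, 4), s(4, 0), s(1, 4)}

/-- `G` contains a (not necessarily induced) subgraph isomorphic to `H`. -/
def ContainsCopy {α β : Type*} (H : SimpleGraph α) (G : SimpleGraph β) : Prop :=
  ∃ f : α → β, Function.Injective f ∧ ∀ ⦃u v⦄, H.Adj u v → G.Adj (f u) (f v)

/-- `v` is incident with two distinct `4`-cycles of `G` that share an edge. -/
def TwoAdjacentFourCyclesAt {V : Type*} (G : SimpleGraph V) (v : V) : Prop :=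
  ∃ (c₁ c₂ : G.Walk v v), c₁.IsCycle ∧ c₂.IsCycle ∧ c₁.length = 4 ∧ c₂.length = 4 ∧
    {e | e ∈ c₁.edges} ≠ {e | e ∈ c₂.edges} ∧ ∃ e, e ∈ c₁.edges ∧ e ∈ c₂.edges

/-- `v` is incident with three pairwise distinct cycles of `G`, of lengths `p`, `q`, `ℓ`. -/
def ThreeCyclesAt {V : Type*} (G : SimpleGraph V) (v : V) (p q ℓ : ℕ) : Prop :=
  ∃ (c₁ c₂ c₃ : G.Walk v v), c₁.IsCycle ∧ c₂.IsCycle ∧ c₃.IsCycle ∧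
    c₁.length = p ∧ c₂.length = q ∧ c₃.length = ℓ ∧
    {e | e ∈ c₁.edges} ≠ {e | e ∈ c₂.edges} ∧
    {e | e ∈ c₁.edges} ≠ {e | e ∈ c₃.edges} ∧
    {e | e ∈ c₂.edges} ≠ {e | e ∈ c₃.edges}

/-- Every `6`-vertex of `G` is not incident with two `4`-cycles sharing an edge, or is not
incident with three cycles of sizes `p, q, ℓ` for any `{p,q,ℓ} ∈ {{3,4,4},{3,3,4}}`. -/
def Good6Vertices {V : Type*} (G : SimpleGraph V) : Prop :=
  ∀ v, vdeg G v = 6 →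
    (¬ TwoAdjacentFourCyclesAt G v) ∨
    (∀ p q ℓ : ℕ, (({p, q, ℓ} : Multiset ℕ) = {3, 4, 4} ∨ ({p, q, ℓ} : Multiset ℕ) = {3, 3, 4}) →
      ¬ ThreeCyclesAt G v p q ℓ)

/-- Reversal of darts, as a permutation. -/
def dartRev {V : Type*} (G : SimpleGraph V) : Equiv.Perm G.Dart :=
  Function.Involutive.toPerm SimpleGraph.Dart.symm SimpleGraph.Dart.symm_involutive

/-- A rotation system (combinatorial embedding) of `G`: a permutation of the darts whose
orbits are exactly the sets of darts emanating from each single vertex. -/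
structure RotationSystem {V : Type*} (G : SimpleGraph V) where
  σ : Equiv.Perm G.Dart
  tail_fixed : ∀ d : G.Dart, (σ d).fst = d.fst
  vertex_cycles : ∀ d d' : G.Dart, d.fst = d'.fst → σ.SameCycle d d'

namespace RotationSystem

variable {V : Type*} {G : SimpleGraph V}

/-- The face-tracing permutation of a rotation system. -/
def φ (R : RotationSystem G) : Equiv.Perm G.Dart :=
  R.σ * dartRev G

/-- Two darts lie on the same face iff they are in the same orbit of the face-tracing
permutation. -/
def faceSetoid (R : RotationSystem G) : Setoid G.Dart where
  r := R.φ.SameCycle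
  iseqv := ⟨fun d => Equiv.Perm.SameCycle.refl _ d, Equiv.Perm.SameCycle.symm,
    Equiv.Perm.SameCycle.trans⟩

/-- The faces of the embedding: orbits of the face-tracing permutation. -/
def Faces (R : RotationSystem G) : Type _ :=
  Quotient R.faceSetoid

/-- The number of faces of the embedding. -/
noncomputable def numFaces (R : RotationSystem G) : ℕ :=
  Nat.card R.Faces

/-- The darts of the face containing the dart `d`. -/
def faceDarts (R : RotationSystem G) (d : G.Dart) : Set G.Dart :=
  {d' | R.φ.SameCycle d d'}

/-- The degree (length of the boundary walk, cut edges counted twice) of the face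
containing the dart `d`. -/
noncomputable def faceDeg (R : RotationSystem G) (d : G.Dart) : ℕ :=
  (R.faceDarts d).ncard

/-- The vertex `v` is incident with the face containing the dart `d`. -/
def FaceIncident (R : RotationSystem G) (v : V) (d : G.Dart) : Prop :=
  ∃ d' ∈ R.faceDarts d, d'.fst = v

/-- A rotation system is a plane embedding when it satisfies Euler's formula
`|V| - |E| + |F| = 2` on each connected component, i.e. `|V| + |F| = |E| + 2c`. -/
def IsPlanarEmbedding [Fintype V] (R : RotationSystem G) : Prop :=
  Fintype.card V + R.numFaces = Nat.card G.edgeSet + 2 * Nat.card G.ConnectedComponent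

end RotationSystem

/-- A graph is planar if it admits a plane embedding. -/
def IsPlanar {V : Type*} [Fintype V] (G : SimpleGraph V) : Prop :=
  ∃ R : RotationSystem G, R.IsPlanarEmbedding

/-- Conditions (1), (2), (3) on graphs in Theorem 1: planar of maximum degree 6, with no
diamond and no house subgraph, and every 6-vertex not incident with two adjacent 4-cycles
or not incident with three cycles of sizes in `{{3,4,4},{3,3,4}}`. -/
def GoodGraph {V : Type*} [Fintype V] (G : SimpleGraph V) : Prop :=
  IsPlanar G ∧ MaxDegreeEq G 6 ∧ ¬ ContainsCopy diamondGraph G ∧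
    ¬ ContainsCopy houseGraph G ∧ Good6Vertices G

/-- `H` is a minimal counterexample to the main theorem: it satisfies conditions (1)–(3),
is not totally 7-colorable, and minimizes `|V| + |E|` among all such graphs. -/
def MinimalCounterexample {V : Type*} [Fintype V] (H : SimpleGraph V) : Prop :=
  GoodGraph H ∧ ¬ TotallyColorable H 7 ∧
    ∀ (n : ℕ) (G : SimpleGraph (Fin n)), GoodGraph G → ¬ TotallyColorable G 7 →
      Fintype.card V + Nat.card H.edgeSet ≤ n + Nat.card G.edgeSet

set_option linter.unusedSectionVars false
section PartA
open scoped Classical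
variable {V : Type*} [Fintype V] {G : SimpleGraph V}

/-- face-boundary property equivalent to planarity -/
def PP (R : RotationSystem G) : Prop :=
  ∀ z : Sym2 V → ZMod 2, (∀ v, (∑ d : G.Dart, if d.fst = v then z d.edge else 0) = 0) →
    ∃ f : G.Dart → ZMod 2, (∀ d, f (R.φ d) = f d) ∧
      ∀ d : G.Dart, f d + f d.symm = z d.edge

/-- edge of a dart -/
def ed (d : G.Dart) : G.edgeSet := ⟨d.edge, d.edge_mem⟩

/-- incidence matrix -/
noncomputable def bmat (G : SimpleGraph V) : Matrix V G.edgeSet (ZMod 2) :=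
  fun v e => ∑ d : G.Dart, if d.fst = v ∧ ed d = e then 1 else 0

lemma bmat_mulVec (z : G.edgeSet → ZMod 2) (v : V) :
    Matrix.mulVec (bmat G) z v = ∑ d : G.Dart, if d.fst = v then z (ed d) else 0 := by
  simp only [Matrix.mulVec, dotProduct, bmat, Finset.sum_mul]
  rw [Finset.sum_comm]
  refine Finset.sum_congr rfl fun d _ => ?_
  by_cases h : d.fst = v <;> simp [h]

lemma sum_fiber {M : Type*} [AddCommMonoid M] (g : G.Dart → M) (d : G.Dart) :
    (∑ d' : G.Dart, if ed d' = ed d then g d' else 0) = g d + g d.symm := by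
  rw [← Finset.sum_filter]
  have : (Finset.univ.filter fun d' : G.Dart => ed d' = ed d) = {d, d.symm} := by
    rw [← Dart.edge_fiber]
    ext d'
    simp [ed]
  rw [this, Finset.sum_pair]
  exact fun h => d.symm_ne h.symm

lemma bmatT_mulVec (h : V → ZMod 2) (d : G.Dart) :
    Matrix.mulVec (bmat G).transpose h (ed d) = h d.fst + h d.snd := by
  have : Matrix.mulVec (bmat G).transpose h (ed d)
      = ∑ d' : G.Dart, if ed d' = ed d then h d'.fst else 0 := by
    simp only [Matrix.mulVec, dotProduct, bmat, Finset.sum_mul, Matrix.transpose_apply]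
    rw [Finset.sum_comm]
    refine Finset.sum_congr rfl fun d' _ => ?_
    by_cases hh : ed d' = ed d <;> simp [hh]
  rw [this, sum_fiber (fun d' => h d'.fst)]
  rfl

lemma ed_surj (e : G.edgeSet) : ∃ d : G.Dart, ed d = e := by
  obtain ⟨e, he⟩ := e
  induction e using Sym2.ind with
  | _ a b => exact ⟨⟨(a, b), he⟩, rfl⟩

lemma z2 {a b : ZMod 2} : a + b = 0 ↔ a = b := by
  revert a b; decide

lemma ker_T : Module.finrank (ZMod 2) (LinearMap.ker (Matrix.mulVecLin (bmat G).transpose))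
    = Nat.card G.ConnectedComponent := by
  have e : (G.ConnectedComponent → ZMod 2) ≃ₗ[ZMod 2]
      (LinearMap.ker (Matrix.mulVecLin (bmat G).transpose)) := by
    have hm : ∀ g : G.ConnectedComponent → ZMod 2, (fun v => g (G.connectedComponentMk v)) ∈
        LinearMap.ker (Matrix.mulVecLin (bmat G).transpose) := by
      intro g
      rw [LinearMap.mem_ker]
      ext e
      obtain ⟨d, rfl⟩ := ed_surj e
      rw [Matrix.mulVecLin_apply, bmatT_mulVec]
      have : G.connectedComponentMk d.fst = G.connectedComponentMk d.snd :=
        ConnectedComponent.sound d.adj.reachable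
      simp [this, z2]
    refine LinearEquiv.ofBijective
      { toFun := fun g => ⟨fun v => g (G.connectedComponentMk v), hm g⟩
        map_add' := fun _ _ => rfl
        map_smul' := fun _ _ => rfl } ⟨?_, ?_⟩
    · intro g g' h
      ext C
      induction C using ConnectedComponent.ind with
      | _ v => exact congrFun (congrArg Subtype.val h) v
    · rintro ⟨h, hh⟩
      have key : ∀ a b, G.Adj a b → h a = h b := by
        intro a b hab
        have := congrFun (LinearMap.mem_ker.1 hh) (ed ⟨(a, b), hab⟩)
        rw [Matrix.mulVecLin_apply, bmatT_mulVec] at this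
        exact z2.1 this
      refine ⟨fun C => C.lift h ?_, ?_⟩
      · intro v w p _
        induction p with
        | nil => rfl
        | cons hab _ ih => exact (key _ _ hab).trans (ih (by simp_all [Walk.cons_isPath_iff]))
      · rfl
  rw [← e.finrank_eq]
  simp [Nat.card_eq_fintype_card]

lemma ker_B : Module.finrank (ZMod 2) (LinearMap.ker (Matrix.mulVecLin (bmat G))) + Fintype.card V
    = Nat.card G.edgeSet + Nat.card G.ConnectedComponent := by
  have h1 := LinearMap.finrank_range_add_finrank_ker (Matrix.mulVecLin (bmat G))
  have h2 := LinearMap.finrank_range_add_finrank_ker (Matrix.mulVecLin (bmat G).transpose)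
  have h3 := Matrix.rank_transpose (bmat G)
  rw [ker_T] at h2
  unfold Matrix.rank at h3
  simp only [Module.finrank_fintype_fun_eq_card] at h1 h2
  rw [Nat.card_eq_fintype_card (α := G.edgeSet)]
  omega

variable (R : RotationSystem G)

noncomputable instance : Fintype R.Faces := by
  unfold RotationSystem.Faces
  infer_instance

/-- face of dart -/
def fc (d : G.Dart) : R.Faces := Quotient.mk R.faceSetoid d

lemma fc_phi (d : G.Dart) : fc R (R.φ d) = fc R d :=
  Quotient.sound (s := R.faceSetoid) (Equiv.Perm.SameCycle.refl R.φ d).apply_left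

lemma phi_symm (d : G.Dart) : R.φ d.symm = R.σ d := by
  simp [RotationSystem.φ, dartRev]

/-- boundary map of faces -/
noncomputable def amap : (R.Faces → ZMod 2) →ₗ[ZMod 2] (G.edgeSet → ZMod 2) where
  toFun g := fun e => ∑ d : G.Dart, if ed d = e then g (fc R d) else 0
  map_add' g g' := by
    ext e
    simp only [Pi.add_apply, ← Finset.sum_add_distrib]
    refine Finset.sum_congr rfl fun d _ => ?_
    split_ifs <;> simp
  map_smul' c g := by
    ext e
    simp only [Pi.smul_apply, smul_eq_mul, Finset.mul_sum, RingHom.id_apply]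
    refine Finset.sum_congr rfl fun d _ => ?_
    split_ifs <;> simp

lemma amap_ed (g : R.Faces → ZMod 2) (d : G.Dart) :
    amap R g (ed d) = g (fc R d) + g (fc R d.symm) :=
  sum_fiber (fun d => g (fc R d)) d

lemma sum_sigma {M : Type*} [AddCommMonoid M] (f : G.Dart → M) (v : V) :
    (∑ d : G.Dart, if d.fst = v then f (R.σ d) else 0) = ∑ d : G.Dart, if d.fst = v then f d else 0 := by
  rw [← Equiv.sum_comp R.σ (fun d => if d.fst = v then f d else 0)]
  simp [R.tail_fixed]

lemma amap_range_le : LinearMap.range (amap R) ≤ LinearMap.ker (Matrix.mulVecLin (bmat G)) := by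
  rintro _ ⟨g, rfl⟩
  rw [LinearMap.mem_ker]
  ext v
  rw [Matrix.mulVecLin_apply, bmat_mulVec]
  simp only [amap_ed]
  have : ∀ d : G.Dart, fc R d.symm = fc R (R.σ d) := by
    intro d
    rw [← phi_symm, fc_phi]
  simp only [this]
  have h2 := sum_sigma R (fun d => g (fc R d)) v
  have : ∀ d : G.Dart, (if d.fst = v then g (fc R d) + g (fc R (R.σ d)) else 0)
     = (if d.fst = v then g (fc R d) else 0) + (if d.fst = v then g (fc R (R.σ d)) else 0) := by
    intro d; split_ifs <;> simp
  simp only [this, Finset.sum_add_distrib, h2]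
  exact z2.2 rfl

lemma const_of_inv {α : Type*} (f : G.Dart → α) (h1 : ∀ d, f (R.φ d) = f d)
    (h2 : ∀ d, f d.symm = f d) : ∀ d d' : G.Dart, G.Reachable d.fst d'.fst → f d = f d' := by
  have hs : ∀ d, f (R.σ d) = f d := by
    intro d
    rw [← phi_symm, h1, h2]
  have hsame : ∀ d d' : G.Dart, d.fst = d'.fst → f d = f d' := by
    intro d d' h
    have hp : ∀ n : ℕ, f ((R.σ ^ n) d) = f d := by
      intro n
      induction n with
      | zero => rfl
      | succ n ih => rw [pow_succ', Equiv.Perm.mul_apply, hs, ih]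
    obtain ⟨n, -, hn⟩ := (R.vertex_cycles d d' h).exists_pow_eq'
    rw [← hn, hp]
  have : ∀ a b, ∀ p : G.Walk a b, ∀ d d' : G.Dart, d.fst = a → d'.fst = b → f d = f d' := by
    intro a b p
    induction p with
    | nil => intro d d' h h'; exact hsame _ _ (h.trans h'.symm)
    | @cons a c b hab p ih =>
      intro d d' h h'
      rw [hsame d ⟨(a, c), hab⟩ h, ← h2]
      exact ih _ _ rfl h'
  rintro d d' ⟨p⟩
  exact this _ _ p d d' rfl rfl

lemma ker_A_const (g : R.Faces → ZMod 2) (hg : amap R g = 0) (d d' : G.Dart)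
    (h : G.Reachable d.fst d'.fst) : g (fc R d) = g (fc R d') := by
  refine const_of_inv R (fun d => g (fc R d)) (fun d => by simp only [fc_phi]) (fun d => ?_) d d' h
  have := congrFun hg (ed d)
  rw [amap_ed] at this
  exact (z2.1 this).symm

lemma ker_A_le : Module.finrank (ZMod 2) (LinearMap.ker (amap R)) ≤ Nat.card G.ConnectedComponent := by
  let P : G.ConnectedComponent → Prop := fun C => ∃ d : G.Dart, G.connectedComponentMk d.fst = C
  let L : LinearMap.ker (amap R) →ₗ[ZMod 2] (G.ConnectedComponent → ZMod 2) :=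
    { toFun := fun g C => if h : P C then g.1 (fc R h.choose) else 0
      map_add' := by
        intro g g'; ext C
        by_cases h : P C <;> simp [h]
      map_smul' := by
        intro c g; ext C
        by_cases h : P C <;> simp [h] }
  have hL : Function.Injective L := by
    rw [← LinearMap.ker_eq_bot, LinearMap.ker_eq_bot']
    rintro ⟨g, hg⟩ h
    ext F
    obtain ⟨d, rfl⟩ := Quotient.exists_rep F
    have hP : P (G.connectedComponentMk d.fst) := ⟨d, rfl⟩
    have h1 := congrFun h (G.connectedComponentMk d.fst)
    have h2 : g (fc R hP.choose) = 0 := by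
      simpa [L, hP] using h1
    exact (ker_A_const R g hg d _ (ConnectedComponent.exact hP.choose_spec.symm)).trans h2
  have := LinearMap.finrank_le_finrank_of_injective hL
  simpa [Nat.card_eq_fintype_card] using this

lemma ker_A_ge (hiso : ∀ v, ∃ d : G.Dart, d.fst = v) :
    Nat.card G.ConnectedComponent ≤ Module.finrank (ZMod 2) (LinearMap.ker (amap R)) := by
  have hwd : ∀ (g : G.ConnectedComponent → ZMod 2) (d d' : G.Dart), R.φ.SameCycle d d' →
      g (G.connectedComponentMk d.fst) = g (G.connectedComponentMk d'.fst) := by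
    intro g d d' h
    obtain ⟨n, -, hn⟩ := h.exists_pow_eq'
    rw [← hn]
    clear hn
    induction n with
    | zero => rfl
    | succ n ih =>
      rw [ih, pow_succ', Equiv.Perm.mul_apply]
      congr 1
      generalize (R.φ ^ n) d = e
      have : (R.φ e).fst = e.snd := by
        have := phi_symm R e.symm
        rw [Dart.symm_symm] at this
        rw [this, R.tail_fixed]; rfl
      rw [this]
      exact ConnectedComponent.sound e.adj.reachable
  let L : (G.ConnectedComponent → ZMod 2) →ₗ[ZMod 2] LinearMap.ker (amap R) :=
    { toFun := fun g => ⟨fun F => Quotient.lift (s := R.faceSetoid)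
          (fun d : G.Dart => g (G.connectedComponentMk d.fst)) (hwd g) F, by
        rw [LinearMap.mem_ker]
        ext e
        obtain ⟨d, rfl⟩ := ed_surj e
        rw [amap_ed]
        refine z2.2 ?_
        change g (G.connectedComponentMk d.fst) = g (G.connectedComponentMk d.snd)
        exact congrArg g (ConnectedComponent.sound d.adj.reachable)⟩
      map_add' := by
        intro g g'; ext F
        obtain ⟨d, rfl⟩ := Quotient.exists_rep F
        rfl
      map_smul' := by
        intro g g'; ext F
        obtain ⟨d, rfl⟩ := Quotient.exists_rep F
        rfl }
  have hL : Function.Injective L := by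
    intro g g' h
    ext C
    induction C using ConnectedComponent.ind with
    | _ v =>
      obtain ⟨d, rfl⟩ := hiso v
      exact congrFun (congrArg Subtype.val h) (fc R d)
  have := LinearMap.finrank_le_finrank_of_injective hL
  simpa [Nat.card_eq_fintype_card] using this

lemma rank_A : Module.finrank (ZMod 2) (LinearMap.range (amap R))
    + Module.finrank (ZMod 2) (LinearMap.ker (amap R)) = R.numFaces := by
  have h1 := LinearMap.finrank_range_add_finrank_ker (amap R)
  rw [h1]
  simp [RotationSystem.numFaces, Nat.card_eq_fintype_card]

lemma PP_iff : PP R ↔ LinearMap.range (amap R) = LinearMap.ker (Matrix.mulVecLin (bmat G)) := by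
  constructor
  · intro h
    refine le_antisymm (amap_range_le R) fun z hz => ?_
    obtain ⟨f, hf1, hf2⟩ := h (fun e => if he : e ∈ G.edgeSet then z ⟨e, he⟩ else 0) (by
      intro v
      have := congrFun (LinearMap.mem_ker.1 hz) v
      rw [Matrix.mulVecLin_apply, bmat_mulVec] at this
      refine Eq.trans ?_ this
      refine Finset.sum_congr rfl fun d _ => ?_
      simp [d.edge_mem, ed])
    refine ⟨fun F => Quotient.lift (s := R.faceSetoid) f ?_ F, ?_⟩
    · intro d d' (h : R.φ.SameCycle d d')
      obtain ⟨n, -, hn⟩ := h.exists_pow_eq'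
      rw [← hn]
      clear hn
      induction n with
      | zero => rfl
      | succ n ih => rw [pow_succ', Equiv.Perm.mul_apply, hf1, ih]
    · ext e
      obtain ⟨d, rfl⟩ := ed_surj e
      rw [amap_ed]
      refine (hf2 d).trans ?_
      simp [d.edge_mem, ed]
  · intro h z hz
    have : (fun e : G.edgeSet => z e.1) ∈ LinearMap.range (amap R) := by
      rw [h, LinearMap.mem_ker]
      ext v
      rw [Matrix.mulVecLin_apply, bmat_mulVec]
      exact hz v
    obtain ⟨g, hg⟩ := this
    refine ⟨fun d => g (fc R d), fun d => by simp only [fc_phi], fun d => ?_⟩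
    rw [← amap_ed, hg]; rfl

lemma PP_of_planar (h : R.IsPlanarEmbedding) : PP R := by
  rw [PP_iff]
  have h1 := ker_A_le R
  have h2 := rank_A R
  have h3 := ker_B (G := G)
  unfold RotationSystem.IsPlanarEmbedding at h
  exact Submodule.eq_of_le_of_finrank_le (amap_range_le R) (by omega)

lemma planar_of_PP (hiso : ∀ v, ∃ d : G.Dart, d.fst = v) (h : PP R) : R.IsPlanarEmbedding := by
  rw [PP_iff] at h
  have h1 := ker_A_le R
  have h1' := ker_A_ge R hiso
  have h2 := rank_A R
  have h3 := ker_B (G := G)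
  rw [h] at h2
  unfold RotationSystem.IsPlanarEmbedding
  omega

lemma euler_of_PP (h : PP R) :
    Nat.card G.edgeSet + Nat.card G.ConnectedComponent ≤ Fintype.card V + R.numFaces := by
  rw [PP_iff] at h
  have h2 := rank_A R
  have h3 := ker_B (G := G)
  rw [h] at h2
  omega
end PartA

set_option linter.unusedSectionVars false
section PartB
open scoped Classical

lemma inv_update {X α : Type*} [DecidableEq X] (σ : Equiv.Perm X) (d : X) (f : X → α)
    (hf : ∀ b, f ((Equiv.swap d (σ d) * σ) b) = f b) :
    ∀ b, Function.update f d (f (σ d)) (σ b) = Function.update f d (f (σ d)) b := by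
  intro b
  by_cases hb : b = d
  · subst hb
    by_cases h : σ b = b
    · rw [h]
    · simp [Function.update_of_ne h]
  · by_cases h : σ b = d
    · have := hf b
      rw [Equiv.Perm.mul_apply, h, Equiv.swap_apply_left] at this
      rw [h, Function.update_self, Function.update_of_ne hb, this]
    · have := hf b
      have h2 : σ b ≠ σ d := fun h => hb (σ.injective h)
      rw [Equiv.Perm.mul_apply, Equiv.swap_apply_of_ne_of_ne h h2] at this
      rw [Function.update_of_ne hb, Function.update_of_ne h, this]

lemma inv_sameCycle {X α : Type*} [Finite X] (σ : Equiv.Perm X) (f : X → α) (hf : ∀ b, f (σ b) = f b)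
    {b b' : X} (h : σ.SameCycle b b') : f b = f b' := by
  obtain ⟨n, -, hn⟩ := h.exists_pow_eq'
  rw [← hn]
  clear hn
  induction n with
  | zero => rfl
  | succ n ih => rw [pow_succ', Equiv.Perm.mul_apply, hf, ih]

variable {V : Type*} [Fintype V] {G : SimpleGraph V}

/-- planarity through the boundary property -/
def Pl (G : SimpleGraph V) : Prop := ∃ R : RotationSystem G, PP R

lemma Pl_del (hG : Pl G) (d : G.Dart) : Pl (G.deleteEdges {d.edge}) := by
  obtain ⟨R, hR⟩ := hG
  set G' := G.deleteEdges {d.edge} with hG'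
  set d' := d.symm with hd'
  have hdd : d ≠ d' := fun h => d.symm_ne h.symm
  set σ := R.σ
  set σ1 := Equiv.swap d (σ d) * σ with hσ1
  set τ := Equiv.swap d' (σ1 d') * σ1 with hτ
  have σ1d : σ1 d = d := by simp [hσ1]
  have τd' : τ d' = d' := by simp [hτ]
  have τd : τ d = d := by
    rw [hτ, Equiv.Perm.mul_apply, σ1d]
    refine Equiv.swap_apply_of_ne_of_ne hdd ?_
    intro h
    exact hdd (σ1.injective (σ1d.trans h))
  have swf : ∀ a b c : G.Dart, a.fst = b.fst → (Equiv.swap a b c).fst = c.fst := by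
    intro a b c h
    rw [Equiv.swap_apply_def]
    split_ifs with h1 h2
    · rw [h1, h]
    · rw [h2, h]
    · rfl
  have hs1 : ∀ a, (σ1 a).fst = a.fst := fun a => by
    rw [hσ1, Equiv.Perm.mul_apply, swf _ _ _ (R.tail_fixed d).symm, R.tail_fixed]
  have hst : ∀ a, (τ a).fst = a.fst := fun a => by
    rw [hτ, Equiv.Perm.mul_apply, swf _ _ _ (hs1 d').symm, hs1]
  let p : G.Dart → Prop := fun a => a ≠ d ∧ a ≠ d'
  have hp : ∀ a, p (τ a) ↔ p a := by
    intro a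
    refine and_congr (not_congr ?_) (not_congr ?_)
    · exact ⟨fun h => τ.injective (h.trans τd.symm), fun h => by rw [h, τd]⟩
    · exact ⟨fun h => τ.injective (h.trans τd'.symm), fun h => by rw [h, τd']⟩
  have hpe : ∀ a : G.Dart, p a ↔ a.edge ≠ d.edge := by
    intro a
    rw [Ne, dart_edge_eq_iff, not_or]
  let ι : {a // p a} ≃ G'.Dart :=
    { toFun := fun a => ⟨a.1.toProd, by
        rw [hG', deleteEdges_adj]
        exact ⟨a.1.adj, fun h => (hpe a.1).1 a.2 h⟩⟩
      invFun := fun a => ⟨⟨a.toProd, (deleteEdges_adj.1 a.adj).1⟩, by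
        rw [hpe]
        exact fun h => (deleteEdges_adj.1 a.adj).2 h⟩
      left_inv := fun a => rfl
      right_inv := fun a => rfl }
  have hcyc : ∀ b b' : G.Dart, p b → p b' → b.fst = b'.fst → τ.SameCycle b b' := by
    intro b b' hb hb' h
    let f : G.Dart → Prop := fun a => τ.SameCycle b a
    have hf : ∀ a, f (τ a) = f a := fun a => by
      simp only [f, Equiv.Perm.sameCycle_apply_right]
    have h1 := inv_update σ1 d' f hf
    have h2 := inv_update σ d _ h1
    have h3 := inv_sameCycle σ _ h2 (R.vertex_cycles b b' h)
    rw [Function.update_of_ne hb.1, Function.update_of_ne hb.2, Function.update_of_ne hb'.1,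
      Function.update_of_ne hb'.2] at h3
    have : f b := Equiv.Perm.SameCycle.refl _ _
    rwa [h3] at this
  let R' : RotationSystem G' :=
    { σ := ι.permCongr (τ.subtypePerm hp)
      tail_fixed := fun a => hst (ι.symm a).1
      vertex_cycles := by
        intro a a' h
        have h1 := hcyc (ι.symm a).1 (ι.symm a').1 (ι.symm a).2 (ι.symm a').2 h
        have h2 : (τ.subtypePerm hp).SameCycle (ι.symm a) (ι.symm a') :=
          Equiv.Perm.sameCycle_subtypePerm.2 h1
        obtain ⟨n, -, hn⟩ := h2.exists_pow_eq'
        refine ⟨n, ?_⟩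
        rw [zpow_natCast]
        have : (ι.permCongr (τ.subtypePerm hp)) ^ n = ι.permCongr ((τ.subtypePerm hp) ^ n) :=
          (map_pow ι.permCongrHom (τ.subtypePerm hp) n).symm
        rw [this, Equiv.permCongr_apply, hn, Equiv.apply_symm_apply] }
  refine ⟨R', ?_⟩
  intro z hz
  obtain ⟨f, hf1, hf2⟩ := hR (fun e => if e = d.edge then 0 else z e) (by
    intro v
    refine Eq.trans ?_ (hz v)
    symm
    refine Finset.sum_bij_ne_zero (fun a _ _ => (ι.symm a).1) ?_ ?_ ?_ ?_
    · intros; simp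
    · intro a _ _ b _ _ h
      exact ι.symm.injective (Subtype.ext h)
    · intro b _ hb
      have hpb : p b := by
        rw [hpe]; intro h; simp [h] at hb
      refine ⟨ι ⟨b, hpb⟩, by simp, ?_, rfl⟩
      rw [if_neg ((hpe b).1 hpb)] at hb
      exact hb
    · intro a _ _
      rw [if_neg ((hpe _).1 (ι.symm a).2)]
      rfl)
  have e1 : f d' = f d := by
    have := hf2 d
    rw [if_pos rfl] at this
    exact (z2.1 this).symm
  have e2 : f (σ d) = f d := by
    rw [← phi_symm R d, hf1]; exact e1
  have e3 : f (σ d') = f d' := by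
    rw [← phi_symm R d', hf1, hd', Dart.symm_symm]; exact e1.symm
  have fsw : ∀ a b c : G.Dart, f a = f b → f (Equiv.swap a b c) = f c := by
    intro a b c h
    rw [Equiv.swap_apply_def]
    split_ifs with h1 h2
    · rw [h1, h]
    · rw [h2, h]
    · rfl
  have f1 : ∀ a, f (σ1 a) = f (σ a) := fun a => fsw _ _ _ e2.symm
  have f2 : ∀ a, f (τ a) = f (σ a) := fun a => by
    rw [hτ, Equiv.Perm.mul_apply, fsw _ _ _ ?_, f1]
    rw [f1, e3]
  refine ⟨fun a => f (ι.symm a).1, ?_, ?_⟩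
  · intro a
    have h1 : R'.φ a = R'.σ a.symm := by
      rw [← phi_symm, Dart.symm_symm]
    rw [h1]
    beta_reduce
    have h2 : (ι.symm (R'.σ a.symm)).1 = τ (ι.symm a).1.symm := by
      simp only [R', Equiv.permCongr_apply, Equiv.symm_apply_apply]
      rfl
    rw [h2, f2, ← phi_symm R, Dart.symm_symm, hf1]
  · intro a
    have := hf2 (ι.symm a).1
    rw [if_neg ((hpe _).1 (ι.symm a).2)] at this
    exact this

lemma Pl_mono {G' : SimpleGraph V} (h : G' ≤ G) (hG : Pl G) : Pl G' := by
  generalize hn : (G.edgeFinset \ G'.edgeFinset).card = n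
  induction n generalizing G with
  | zero =>
    have : G ≤ G' := by
      rw [Finset.card_eq_zero, Finset.sdiff_eq_empty_iff_subset, edgeFinset_subset_edgeFinset] at hn
      exact hn
    rwa [le_antisymm h this]
  | succ n ih =>
    have : (G.edgeFinset \ G'.edgeFinset).Nonempty := by
      rw [← Finset.card_pos]; omega
    obtain ⟨e, he⟩ := this
    have he' := Finset.mem_sdiff.1 he
    rw [mem_edgeFinset, mem_edgeFinset] at he'
    obtain ⟨d, hd⟩ := ed_surj ⟨e, he'.1⟩
    have hd : d.edge = e := congrArg Subtype.val hd
    refine ih (G := G.deleteEdges {d.edge}) ?_ (Pl_del hG d) ?_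
    · intro a b hab
      rw [deleteEdges_adj]
      refine ⟨h hab, fun h' => he'.2 ?_⟩
      rw [hd] at h'
      rw [← (show s(a, b) = e from h')]
      exact hab
    · have : (G.deleteEdges {d.edge}).edgeFinset \ G'.edgeFinset
          = (G.edgeFinset \ G'.edgeFinset).erase e := by
        ext e'
        simp only [Finset.mem_sdiff, mem_edgeFinset, edgeSet_deleteEdges, Finset.mem_erase, hd,
          Set.mem_sdiff, Set.mem_singleton_iff]
        tauto
      have h3 := congrArg Finset.card this
      rw [Finset.card_erase_of_mem he, hn] at h3
      rw [Nat.add_sub_cancel] at h3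
      convert h3

lemma Pl_comap {W : Type*} [Fintype W] (ι : W ↪ V) (hι : ∀ a b, G.Adj a b → a ∈ Set.range ι)
    (hG : Pl G) : Pl (G.comap ι) := by
  obtain ⟨R, hR⟩ := hG
  set G' := G.comap ι
  let κ : G'.Dart ≃ G.Dart := Equiv.ofBijective
    (fun a => ⟨(ι a.fst, ι a.snd), a.adj⟩) (by
      constructor
      · intro a b h
        have h1 := congrArg (fun d : G.Dart => d.fst) h
        have h2 := congrArg (fun d : G.Dart => d.snd) h
        exact Dart.ext _ _ (Prod.ext (ι.injective h1) (ι.injective h2))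
      · rintro ⟨⟨a, b⟩, hab⟩
        obtain ⟨a, rfl⟩ := hι _ _ hab
        obtain ⟨b, rfl⟩ := hι _ _ hab.symm
        exact ⟨⟨(a, b), hab⟩, rfl⟩)
  have κf : ∀ a, (κ a).fst = ι a.fst := fun a => rfl
  have κs : ∀ a, (κ a).symm = κ a.symm := fun a => rfl
  have κe : ∀ a, (κ a).edge = Sym2.map ι a.edge := fun a => rfl
  let R' : RotationSystem G' :=
    { σ := κ.symm.permCongr R.σ
      tail_fixed := fun a => by
        apply ι.injective
        rw [← κf, Equiv.permCongr_apply, Equiv.apply_symm_apply, R.tail_fixed]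
        rfl
      vertex_cycles := by
        intro a a' h
        have h2 := R.vertex_cycles (κ a) (κ a') (congrArg ι h)
        obtain ⟨n, -, hn⟩ := h2.exists_pow_eq'
        refine ⟨n, ?_⟩
        rw [zpow_natCast]
        have : (κ.symm.permCongr R.σ) ^ n = κ.symm.permCongr (R.σ ^ n) :=
          (map_pow κ.symm.permCongrHom R.σ n).symm
        rw [this, Equiv.permCongr_apply, Equiv.symm_symm, hn, Equiv.symm_apply_apply] }
  refine ⟨R', ?_⟩
  intro z hz
  have hinj : Function.Injective (Sym2.map ι) := Sym2.map.injective ι.injective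
  obtain ⟨f, hf1, hf2⟩ := hR (Function.extend (Sym2.map ι) z 0) (by
    intro v
    rw [← Equiv.sum_comp κ]
    simp only [κe, κf, hinj.extend_apply]
    by_cases hv : v ∈ Set.range ι
    · obtain ⟨w, rfl⟩ := hv
      simp only [ι.injective.eq_iff]
      exact hz w
    · refine Finset.sum_eq_zero fun a _ => if_neg fun h => hv ⟨_, h⟩)
  refine ⟨fun a => f (κ a), ?_, ?_⟩
  · intro a
    have h1 : R'.φ a = R'.σ a.symm := by
      rw [← phi_symm, Dart.symm_symm]
    rw [h1]
    beta_reduce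
    have h2 : κ (R'.σ a.symm) = R.σ (κ a).symm := by
      simp only [R', Equiv.permCongr_apply, Equiv.symm_symm, Equiv.apply_symm_apply, κs]
    rw [h2, ← phi_symm R, Dart.symm_symm, hf1]
  · intro a
    have := hf2 (κ a)
    rw [κe, hinj.extend_apply, κs] at this
    exact this
end PartB

set_option linter.unusedSectionVars false
section PartC
open scoped Classical
variable {V : Type*} [Fintype V] {K : SimpleGraph V}

/-- conflict relation of the total graph -/
def cf (K : SimpleGraph V) : V ⊕ Sym2 V → V ⊕ Sym2 V → Prop
  | .inl u, .inl v => K.Adj u v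
  | .inl u, .inr e => e ∈ K.edgeSet ∧ u ∈ e
  | .inr e, .inl u => e ∈ K.edgeSet ∧ u ∈ e
  | .inr e, .inr f => e ∈ K.edgeSet ∧ f ∈ K.edgeSet ∧ e ≠ f ∧ ∃ x, x ∈ e ∧ x ∈ f

lemma cf_symm : ∀ {a b : V ⊕ Sym2 V}, cf K a b → cf K b a
  | .inl _, .inl _, h => SimpleGraph.Adj.symm h
  | .inl _, .inr _, h => h
  | .inr _, .inl _, h => h
  | .inr _, .inr _, ⟨h1, h2, h3, x, h4, h5⟩ => ⟨h2, h1, h3.symm, x, h5, h4⟩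

lemma tc_iff : TotallyColorable K 7 ↔ ∃ c : V ⊕ Sym2 V → Fin 7, ∀ a b, cf K a b → c a ≠ c b := by
  constructor
  · rintro ⟨cv, ce, h1, h2, h3⟩
    have h4 : ∀ e ∈ K.edgeSet, ∀ u ∈ e, ce e ≠ cv u := by
      intro e he u hu
      obtain ⟨w, rfl⟩ := Sym2.mem_iff_exists.1 hu
      exact h3 he
    refine ⟨Sum.elim cv ce, ?_⟩
    rintro (u | e) (v | f) h
    · exact h1 h
    · exact (h4 _ h.1 _ h.2).symm
    · exact h4 _ h.1 _ h.2
    · exact h2 _ h.1 _ h.2.1 h.2.2.1 h.2.2.2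
  · rintro ⟨c, hc⟩
    refine ⟨fun v => c (.inl v), fun e => c (.inr e), ?_, ?_, ?_⟩
    · intro u v h
      exact hc (.inl u) (.inl v) h
    · intro e he f hf hne hx
      exact hc (.inr e) (.inr f) ⟨he, hf, hne, hx⟩
    · intro u v h
      exact hc (.inr s(u, v)) (.inl u) ⟨h, Sym2.mem_mk_left _ _⟩

/-- conflict neighbours -/
noncomputable def nf (K : SimpleGraph V) (a : V ⊕ Sym2 V) : Finset (V ⊕ Sym2 V) :=
  Finset.univ.filter (cf K a)

/-- neighbor finset -/
noncomputable def nb (K : SimpleGraph V) (u : V) : Finset V := Finset.univ.filter (K.Adj u)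

lemma nb_card (u : V) : (nb K u).card = vdeg K u := by
  unfold nb vdeg
  rw [Nat.card_eq_fintype_card, Fintype.card_subtype]
  congr 1

lemma nf_inl (u : V) : (nf K (.inl u)).card ≤ 2 * vdeg K u := by
  have : nf K (.inl u) ⊆ (nb K u).image Sum.inl ∪ (nb K u).image (fun w => Sum.inr s(u, w)) := by
    rintro (v | e) h
    · have h : K.Adj u v := (Finset.mem_filter.1 h).2
      simp [nb, h]
    · have h : e ∈ K.edgeSet ∧ u ∈ e := (Finset.mem_filter.1 h).2
      obtain ⟨w, rfl⟩ := Sym2.mem_iff_exists.1 h.2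
      have : K.Adj u w := h.1
      refine Finset.mem_union_right _ (Finset.mem_image.2 ⟨w, ?_, rfl⟩)
      simp [nb, this]
  have h2 := (Finset.card_le_card this).trans (Finset.card_union_le _ _)
  have h3 : ((nb K u).image (Sum.inl : V → V ⊕ Sym2 V)).card ≤ _ := Finset.card_image_le
  have h4 : ((nb K u).image (fun w => (Sum.inr s(u, w) : V ⊕ Sym2 V))).card ≤ _ := Finset.card_image_le
  rw [nb_card] at h3 h4
  omega

lemma nf_inr (x y : V) (hxy : K.Adj x y) : (nf K (.inr s(x, y))).card ≤ vdeg K x + vdeg K y := by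
  have : nf K (.inr s(x, y)) ⊆ ({.inl x, .inl y} : Finset (V ⊕ Sym2 V)) ∪
      (((nb K x).erase y).image (fun w => Sum.inr s(x, w)) ∪
      ((nb K y).erase x).image (fun w => Sum.inr s(y, w))) := by
    rintro (v | e) h
    · have h : s(x, y) ∈ K.edgeSet ∧ v ∈ s(x, y) := (Finset.mem_filter.1 h).2
      rcases Sym2.mem_iff.1 h.2 with rfl | rfl <;> simp
    · obtain ⟨-, h1, h2, z, h3, h4⟩ := (Finset.mem_filter.1 h).2
      obtain ⟨w, rfl⟩ := Sym2.mem_iff_exists.1 h4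
      have hzw : K.Adj z w := h1
      rcases Sym2.mem_iff.1 h3 with rfl | rfl
      · refine Finset.mem_union_right _ (Finset.mem_union_left _ (Finset.mem_image.2 ⟨w, ?_, rfl⟩))
        simp only [nb, Finset.mem_erase, Finset.mem_filter, Finset.mem_univ, true_and]
        exact ⟨fun h => h2 (by rw [h]), hzw⟩
      · refine Finset.mem_union_right _ (Finset.mem_union_right _ (Finset.mem_image.2 ⟨w, ?_, rfl⟩))
        simp only [nb, Finset.mem_erase, Finset.mem_filter, Finset.mem_univ, true_and]
        exact ⟨fun h => h2 (by rw [h, Sym2.eq_swap]), hzw⟩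
  have h2 := (Finset.card_le_card this).trans (Finset.card_union_le _ _)
  have h2' := Finset.card_union_le (((nb K x).erase y).image (fun w => (Sum.inr s(x, w) : V ⊕ Sym2 V)))
      (((nb K y).erase x).image (fun w => Sum.inr s(y, w)))
  have h3 : (((nb K x).erase y).image (fun w => (Sum.inr s(x, w) : V ⊕ Sym2 V))).card ≤ _ :=
    Finset.card_image_le
  have h4 : (((nb K y).erase x).image (fun w => (Sum.inr s(y, w) : V ⊕ Sym2 V))).card ≤ _ :=
    Finset.card_image_le
  have m1 : y ∈ nb K x := by simp [nb, hxy]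
  have m2 : x ∈ nb K y := by simp [nb, hxy.symm]
  have p1 := Finset.card_pos.2 ⟨y, m1⟩
  have p2 := Finset.card_pos.2 ⟨x, m2⟩
  rw [Finset.card_erase_of_mem m1, nb_card] at h3
  rw [Finset.card_erase_of_mem m2, nb_card] at h4
  rw [nb_card] at p1 p2
  have := Finset.card_le_two (a := (Sum.inl x : V ⊕ Sym2 V)) (b := .inl y)
  omega

lemma extend_col (D : Set (Sym2 V)) (S : Finset (V ⊕ Sym2 V)) (hD : ∀ e ∈ D, .inr e ∈ S)
    (hD2 : ∀ e ∈ D, ∃ x ∈ e, .inl x ∈ S) (hc : TotallyColorable (K.deleteEdges D) 7)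
    (hext : ∀ L : V ⊕ Sym2 V → Finset (Fin 7),
      (∀ s, ∀ A ⊆ S, (∀ a ∈ A, cf K s a) → 7 + A.card ≤ (L s).card + (nf K s).card) →
      ∃ c : V ⊕ Sym2 V → Fin 7, (∀ s ∈ S, c s ∈ L s) ∧
        ∀ s ∈ S, ∀ t ∈ S, cf K s t → c s ≠ c t) : TotallyColorable K 7 := by
  rw [tc_iff] at hc ⊢
  obtain ⟨c, hc⟩ := hc
  have key : ∀ a b, a ∉ S → b ∉ S → cf K a b → c a ≠ c b := by
    intro a b ha hb hab
    apply hc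
    have hE : ∀ e ∈ K.edgeSet, .inr e ∉ S → e ∈ (K.deleteEdges D).edgeSet := by
      intro e he hS
      rw [edgeSet_deleteEdges]
      exact ⟨he, fun h => hS (hD e h)⟩
    rcases a with u | e <;> rcases b with v | f
    · change (K.deleteEdges D).Adj u v
      rw [deleteEdges_adj]
      refine ⟨hab, fun h => ?_⟩
      obtain ⟨x, hx, hxS⟩ := hD2 _ h
      rcases Sym2.mem_iff.1 hx with rfl | rfl
      · exact ha hxS
      · exact hb hxS
    · exact ⟨hE _ hab.1 hb, hab.2⟩
    · exact ⟨hE _ hab.1 ha, hab.2⟩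
    · exact ⟨hE _ hab.1 ha, hE _ hab.2.1 hb, hab.2.2⟩
  let L : V ⊕ Sym2 V → Finset (Fin 7) := fun s => Finset.univ \ (nf K s \ S).image c
  obtain ⟨c', h1, h2⟩ := hext L (by
    intro s A hA hAs
    have e1 : (L s).card = 7 - ((nf K s \ S).image c).card := by
      simp only [L]
      rw [← Finset.compl_eq_univ_sdiff, Finset.card_compl, Fintype.card_fin]
    have e2 : ((nf K s \ S).image c).card ≤ (nf K s \ S).card := Finset.card_image_le
    have e3 : A ⊆ nf K s := fun a ha => by simp [nf, hAs a ha]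
    have e4 : (nf K s \ S) ⊆ nf K s \ A := Finset.sdiff_subset_sdiff le_rfl hA
    have e5 := Finset.card_le_card e4
    rw [Finset.card_sdiff_of_subset e3] at e5
    have e6 := Finset.card_le_card e3
    omega)
  have h3 : ∀ s ∈ S, ∀ t ∉ S, cf K s t → c' s ≠ c t := by
    intro s hs t ht hst h
    have := h1 s hs
    simp only [L, Finset.mem_sdiff, Finset.mem_univ, true_and, Finset.mem_image, not_exists] at this
    exact this t ⟨⟨by simp [nf, hst], ht⟩, h.symm⟩
  refine ⟨fun a => if a ∈ S then c' a else c a, ?_⟩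
  intro a b hab
  by_cases ha : a ∈ S <;> by_cases hb : b ∈ S <;> simp only [ha, hb, if_true, if_false]
  · exact h2 a ha b hb hab
  · exact h3 a ha b hb hab
  · exact (h3 b hb a ha (cf_symm hab)).symm
  · exact key a b ha hb hab

lemma c4_list {A B C D : Finset (Fin 7)} (hA : 2 ≤ A.card) (hB : 2 ≤ B.card) (hC : 2 ≤ C.card)
    (hD : 2 ≤ D.card) : ∃ a ∈ A, ∃ b ∈ B, ∃ c ∈ C, ∃ d ∈ D, a ≠ b ∧ b ≠ c ∧ c ≠ d ∧ d ≠ a := by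
  have pick : ∀ {X : Finset (Fin 7)} (_ : 2 ≤ X.card) (p : Fin 7), ∃ x ∈ X, x ≠ p := by
    intro X hX p
    have : 0 < (X.erase p).card := by
      have := Finset.pred_card_le_card_erase (s := X) (a := p); omega
    obtain ⟨x, hx⟩ := Finset.card_pos.1 this
    exact ⟨x, Finset.mem_of_mem_erase hx, Finset.ne_of_mem_erase hx⟩
  have main : ∀ {A B C D : Finset (Fin 7)} (_ : 2 ≤ A.card) (_ : 2 ≤ B.card) (_ : 2 ≤ C.card)
    (_ : 2 ≤ D.card), ¬ A ⊆ B → ∃ a ∈ A, ∃ b ∈ B, ∃ c ∈ C, ∃ d ∈ D, a ≠ b ∧ b ≠ c ∧ c ≠ d ∧ d ≠ a := by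
    intro A B C D hA hB hC hD h
    obtain ⟨a, ha, hab⟩ := Finset.not_subset.1 h
    obtain ⟨d, hd, hda⟩ := pick hD a
    obtain ⟨c, hc, hcd⟩ := pick hC d
    obtain ⟨b, hb, hbc⟩ := pick hB c
    exact ⟨a, ha, b, hb, c, hc, d, hd, fun h => hab (h ▸ hb), hbc, hcd, hda⟩
  by_cases h1 : A ⊆ B
  · by_cases h2 : B ⊆ C
    · by_cases h3 : C ⊆ D
      · by_cases h4 : D ⊆ A
        · obtain ⟨x, hx⟩ := Finset.card_pos.1 (show 0 < A.card by omega)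
          obtain ⟨y, hy, hyx⟩ := pick hA x
          exact ⟨x, hx, y, h1 hy, x, h2 (h1 hx), y, h3 (h2 (h1 hy)), hyx.symm, hyx, hyx.symm, hyx⟩
        · obtain ⟨d, hd, a, ha, b, hb, c, hc, h⟩ := main hD hA hB hC h4
          exact ⟨a, ha, b, hb, c, hc, d, hd, h.2.1, h.2.2.1, h.2.2.2, h.1⟩
      · obtain ⟨c, hc, d, hd, a, ha, b, hb, h⟩ := main hC hD hA hB h3
        exact ⟨a, ha, b, hb, c, hc, d, hd, h.2.2.1, h.2.2.2, h.1, h.2.1⟩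
    · obtain ⟨b, hb, c, hc, d, hd, a, ha, h⟩ := main hB hC hD hA h2
      exact ⟨a, ha, b, hb, c, hc, d, hd, h.2.2.2, h.1, h.2.1, h.2.2.1⟩
  · exact main hA hB hC hD h1

/-- K_{2,2,2} is 3-choosable; parts (0,3), (1,4), (2,5) -/
lemma oct_list (L : Fin 6 → Finset (Fin 7)) (hL : ∀ i, 3 ≤ (L i).card) :
    ∃ c : Fin 6 → Fin 7, (∀ i, c i ∈ L i) ∧ ∀ i j, i ≠ j → j ≠ i + 3 → c i ≠ c j := by
  have main : ∀ k l : Fin 6, ∀ p ∈ L k, p ∈ L (k + 3) → l = k + 1 →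
      ∃ c : Fin 6 → Fin 7, (∀ i, c i ∈ L i) ∧ ∀ i j, i ≠ j → j ≠ i + 3 → c i ≠ c j := by
    intro k l p h1 h2 hl
    have er : ∀ i, 2 ≤ ((L i).erase p).card := fun i => by
      have := Finset.pred_card_le_card_erase (s := L i) (a := p)
      have := hL i
      omega
    obtain ⟨a, ha, b, hb, c, hc, d, hd, h⟩ := c4_list (er (k+1)) (er (k+2)) (er (k+4)) (er (k+5))
    rw [Finset.mem_erase] at ha hb hc hd
    refine ⟨fun i => if i = k then p else if i = k + 3 then p else if i = k + 1 then a else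
      if i = k + 2 then b else if i = k + 4 then c else d, ?_, ?_⟩
    · intro i
      clear hl
      fin_cases k <;> fin_cases i <;> simp_all
    · intro i j
      obtain ⟨h5, h6, h7, h8⟩ := h
      have := ha.1
      have := hb.1
      have := hc.1
      have := hd.1
      clear ha hb hc hd er h1 h2 hL hl
      fin_cases k <;> fin_cases i <;> fin_cases j <;> simp <;> (first | assumption | (refine Ne.symm ?_; assumption))
  by_cases h : ∃ k, ∃ p ∈ L k, p ∈ L (k + 3)
  · obtain ⟨k, p, h1, h2⟩ := h
    exact main k _ p h1 h2 rfl
  · push Not at h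
    have : ∀ S : Finset (Fin 6), S.card ≤ (S.biUnion L).card := by
      intro S
      by_cases hS : ∃ k ∈ S, k + 3 ∈ S
      · obtain ⟨k, h1, h2⟩ := hS
        have hd : Disjoint (L k) (L (k + 3)) := Finset.disjoint_left.2 fun p hp => h k p hp
        have h3 : L k ∪ L (k + 3) ⊆ S.biUnion L :=
          Finset.union_subset (Finset.subset_biUnion_of_mem L h1) (Finset.subset_biUnion_of_mem L h2)
        have h4 := Finset.card_le_card h3
        rw [Finset.card_union_of_disjoint hd] at h4
        have := hL k
        have := hL (k + 3)
        have h5 : S.card ≤ 6 := by simpa using Finset.card_le_univ S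
        omega
      · have h3 : S.card ≤ 3 := by
          revert S; decide
        rcases S.eq_empty_or_nonempty with rfl | ⟨k, hk⟩
        · simp
        · have := Finset.card_le_card (Finset.subset_biUnion_of_mem L hk)
          have := hL k
          omega
    obtain ⟨f, hf, hf2⟩ := (Finset.all_card_le_biUnion_card_iff_exists_injective L).1 this
    exact ⟨f, hf2, fun i j hij _ h => hij (hf h)⟩

lemma extend_F {n : ℕ} (g : Fin n → V ⊕ Sym2 V) (hg : Function.Injective g) (D : Set (Sym2 V))
    (hD : ∀ e ∈ D, ∃ i, g i = .inr e) (hD2 : ∀ e ∈ D, ∃ x ∈ e, ∃ i, g i = .inl x)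
    (hc : TotallyColorable (K.deleteEdges D) 7)
    (hext : ∀ L : Fin n → Finset (Fin 7),
      (∀ i, ∀ A : Finset (Fin n), (∀ a ∈ A, cf K (g i) (g a)) →
        7 + A.card ≤ (L i).card + (nf K (g i)).card) →
      ∃ c : Fin n → Fin 7, (∀ i, c i ∈ L i) ∧ ∀ i j, cf K (g i) (g j) → c i ≠ c j) :
    TotallyColorable K 7 := by
  refine extend_col D (Finset.univ.image g) ?_ ?_ hc ?_
  · intro e he
    obtain ⟨i, hi⟩ := hD e he
    exact Finset.mem_image.2 ⟨i, Finset.mem_univ _, hi⟩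
  · intro e he
    obtain ⟨x, hx, i, hi⟩ := hD2 e he
    exact ⟨x, hx, Finset.mem_image.2 ⟨i, Finset.mem_univ _, hi⟩⟩
  · intro L hL
    obtain ⟨c, h1, h2⟩ := hext (fun i => L (g i)) (by
      intro i A hA
      have := hL (g i) (A.image g) (Finset.image_subset_image (Finset.subset_univ _)) (by
        intro a ha
        obtain ⟨j, hj, rfl⟩ := Finset.mem_image.1 ha
        exact hA j hj)
      rwa [Finset.card_image_of_injective _ hg] at this)
    refine ⟨Function.extend g c (fun _ => 0), ?_, ?_⟩
    · intro s hs
      obtain ⟨i, -, rfl⟩ := Finset.mem_image.1 hs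
      rw [hg.extend_apply]
      exact h1 i
    · intro s hs t ht hst
      obtain ⟨i, -, rfl⟩ := Finset.mem_image.1 hs
      obtain ⟨j, -, rfl⟩ := Finset.mem_image.1 ht
      rw [hg.extend_apply, hg.extend_apply]
      exact h2 i j hst

lemma red1 {u v : V} (huv : K.Adj u v) (h3 : vdeg K u ≤ 3) (h7 : vdeg K u + vdeg K v ≤ 7)
    (hc : TotallyColorable (K.deleteEdges {s(u, v)}) 7) : TotallyColorable K 7 := by
  refine extend_F ![.inl u, .inr s(u, v)] ?_ {s(u, v)} ?_ ?_ hc ?_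
  · intro i j
    fin_cases i <;> fin_cases j <;> simp
  · rintro e rfl
    exact ⟨1, rfl⟩
  · rintro e rfl
    exact ⟨u, by simp, 0, rfl⟩
  · intro L hL
    have h1 := hL 1 {0} (by simpa [cf] using huv)
    have h0 := hL 0 {1} (by simpa [cf] using huv)
    have n1 := nf_inr u v huv
    have n0 := nf_inl (K := K) u
    simp at h1 h0
    obtain ⟨x, hx⟩ := Finset.card_pos.1 (show 0 < (L 1).card by omega)
    have : 0 < ((L 0).erase x).card := by
      have := Finset.pred_card_le_card_erase (s := L 0) (a := x); omega
    obtain ⟨y, hy⟩ := Finset.card_pos.1 this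
    rw [Finset.mem_erase] at hy
    refine ⟨![y, x], ?_, ?_⟩
    · intro i
      fin_cases i
      · exact hy.2
      · exact hx
    · intro i j
      fin_cases i <;> fin_cases j <;> simp [cf]
      · intros; exact hy.1
      · intros; exact hy.1.symm

lemma red2 {x1 y1 x2 y2 : V} (h1 : K.Adj x1 y1) (h2 : K.Adj y1 x2) (h3 : K.Adj x2 y2)
    (h4 : K.Adj y2 x1) (hx : x1 ≠ x2) (hy : y1 ≠ y2) (hn : ¬ K.Adj x1 x2)
    (d1 : vdeg K x1 ≤ 3) (d2 : vdeg K x2 ≤ 3) (e1 : vdeg K y1 ≤ 5) (e2 : vdeg K y2 ≤ 5)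
    (hc : TotallyColorable (K.deleteEdges {s(x1, y1), s(y1, x2), s(x2, y2), s(y2, x1)}) 7) :
    TotallyColorable K 7 := by
  have q1 := h1.ne
  have q2 := h2.ne
  have q3 := h3.ne
  have q4 := h4.ne
  refine extend_F ![.inl x1, .inl x2, .inr s(x1, y1), .inr s(y1, x2), .inr s(x2, y2), .inr s(y2, x1)]
    ?_ _ ?_ ?_ hc ?_
  · intro i j
    fin_cases i <;> fin_cases j <;> simp <;> grind
  · rintro e (rfl | rfl | rfl | rfl)
    exacts [⟨2, rfl⟩, ⟨3, rfl⟩, ⟨4, rfl⟩, ⟨5, rfl⟩]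
  · rintro e (rfl | rfl | rfl | rfl)
    exacts [⟨x1, by simp, 0, rfl⟩, ⟨x2, by simp, 1, rfl⟩, ⟨x2, by simp, 1, rfl⟩, ⟨x1, by simp, 0, rfl⟩]
  · intro L hL
    have l0 := hL 0 {2, 5} (by simp [cf, *])
    have l1 := hL 1 {3, 4} (by simp [cf, *])
    have l2 := hL 2 {0, 3, 5} (by simp [cf, *]; grind)
    have l3 := hL 3 {1, 2, 4} (by simp [cf, *]; grind)
    have l4 := hL 4 {1, 3, 5} (by simp [cf, *]; grind)
    have l5 := hL 5 {0, 2, 4} (by simp [cf, *]; grind)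
    have n0 := nf_inl (K := K) x1
    have n1 := nf_inl (K := K) x2
    have n2 := nf_inr _ _ h1
    have n3 := nf_inr _ _ h2
    have n4 := nf_inr _ _ h3
    have n5 := nf_inr _ _ h4
    simp at l0 l1 l2 l3 l4 l5
    obtain ⟨a, ha, b, hb, c, hc, d, hd, k1, k2, k3, k4⟩ :=
      c4_list (show 2 ≤ (L 2).card by omega) (show 2 ≤ (L 3).card by omega)
        (show 2 ≤ (L 4).card by omega) (show 2 ≤ (L 5).card by omega)
    have pick : ∀ {X : Finset (Fin 7)} (_ : 3 ≤ X.card) (p q : Fin 7), ∃ x ∈ X, x ≠ p ∧ x ≠ q := by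
      intro X hX p q
      have : 0 < ((X.erase p).erase q).card := by
        have := Finset.pred_card_le_card_erase (s := X) (a := p)
        have := Finset.pred_card_le_card_erase (s := X.erase p) (a := q); omega
      obtain ⟨x, hx⟩ := Finset.card_pos.1 this
      simp only [Finset.mem_erase] at hx
      exact ⟨x, hx.2.2, hx.2.1, hx.1⟩
    obtain ⟨p, hp, hp1, hp2⟩ := pick (show 3 ≤ (L 0).card by omega) a d
    obtain ⟨q, hq, hq1, hq2⟩ := pick (show 3 ≤ (L 1).card by omega) b c
    refine ⟨![p, q, a, b, c, d], ?_, ?_⟩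
    · intro i
      fin_cases i <;> assumption
    · have hn2 : ¬ K.Adj x2 x1 := fun h => hn h.symm
      clear hL l0 l1 l2 l3 l4 l5 n0 n1 n2 n3 n4 n5
      intro i j
      fin_cases i <;> fin_cases j <;> simp [cf, *] <;> grind

lemma red3 {a b c : V} (h1 : K.Adj a b) (h2 : K.Adj b c) (h3 : K.Adj c a)
    (d1 : vdeg K a ≤ 4) (d2 : vdeg K b ≤ 4) (d3 : vdeg K c ≤ 4)
    (hc : TotallyColorable (K.deleteEdges {s(b, c), s(c, a), s(a, b)}) 7) :
    TotallyColorable K 7 := by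
  have q1 := h1.ne
  have q2 := h2.ne
  have q3 := h3.ne
  have g1 := h1.symm
  have g2 := h2.symm
  have g3 := h3.symm
  refine extend_F ![.inl a, .inl b, .inl c, .inr s(b, c), .inr s(c, a), .inr s(a, b)]
    ?_ _ ?_ ?_ hc ?_
  · intro i j
    fin_cases i <;> fin_cases j <;> simp <;> grind
  · rintro e (rfl | rfl | rfl)
    exacts [⟨3, rfl⟩, ⟨4, rfl⟩, ⟨5, rfl⟩]
  · rintro e (rfl | rfl | rfl)
    exacts [⟨b, by simp, 1, rfl⟩, ⟨c, by simp, 2, rfl⟩, ⟨a, by simp, 0, rfl⟩]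
  · intro L hL
    have n0 := nf_inl (K := K) a
    have n1 := nf_inl (K := K) b
    have n2 := nf_inl (K := K) c
    have n3 := nf_inr _ _ h2
    have n4 := nf_inr _ _ h3
    have n5 := nf_inr _ _ h1
    have l0 := hL 0 {1, 2, 4, 5} (by simp [cf, *])
    have l1 := hL 1 {0, 2, 3, 5} (by simp [cf, *])
    have l2 := hL 2 {0, 1, 3, 4} (by simp [cf, *])
    have l3 := hL 3 {1, 2, 4, 5} (by simp [cf, *]; grind)
    have l4 := hL 4 {0, 2, 3, 5} (by simp [cf, *]; grind)
    have l5 := hL 5 {0, 1, 3, 4} (by simp [cf, *]; grind)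
    simp at l0 l1 l2 l3 l4 l5
    obtain ⟨c, k1, k2⟩ := oct_list L (by intro i; fin_cases i <;> simp <;> omega)
    refine ⟨c, k1, ?_⟩
    intro i j hij
    apply k2
    · rintro rfl
      revert hij
      fin_cases i <;> simp [cf]
    · rintro rfl
      revert hij
      fin_cases i <;> simp [cf] <;> grind
end PartC

set_option linter.unusedSectionVars false
section PartD

/-- weight of a code -/
def wt (a : Fin 3) : ℤ := if a = 0 then 20 else if a = 1 then 15 else 12

/-- initial charge of a dart -/
def w0 (p a b : Fin 3) : ℤ := 2 * wt p + wt a + wt b - 60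

/-- transfer -/
def tr (p s a b : Fin 3) : ℤ :=
  if p = 0 then - w0 0 a b else if s = 0 then w0 0 a b else
  if a = 0 ∨ b = 0 then (if p = 2 ∧ s = 1 then 4 else if p = 1 ∧ s = 2 then -4 else 0) else 0

/-- consecutive faces condition -/
def okf (a b : Fin 3) : Prop := (a = 0 → b = 2) ∧ (b = 0 → a = 2)

/-- consecutive neighbours condition -/
def okn (s b t : Fin 3) : Prop :=
  (b = 0 → (s = 0 → t = 2) ∧ (t = 0 → s = 2)) ∧ (b = 1 → ¬ (s = 0 ∧ t = 0))

instance (a b : Fin 3) : Decidable (okf a b) := by unfold okf; infer_instance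
instance (a b c : Fin 3) : Decidable (okn a b c) := by unfold okn; infer_instance

lemma tr_anti : ∀ p s a b : Fin 3, ¬ (p = 0 ∧ s = 0) → tr p s a b = - tr s p b a := by decide

/-- upper bound of final charge at a 5-vertex, shifted by 12 -/
def v5 (a s b : Fin 3) : ℕ :=
  if a = 0 ∨ b = 0 then (if s = 0 then 20 else if s = 1 then 12 else 8) else
  if a = 1 ∧ b = 1 then (if s = 0 then 16 else 6) else
  if a = 1 ∨ b = 1 then (if s = 0 then 10 else 3) else (if s = 0 then 4 else 0)

lemma v5_le : ∀ a s b : Fin 3, okf a b → w0 2 a b + tr 2 s a b ≤ (v5 a s b : ℤ) - 12 := by decide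

set_option maxRecDepth 100000 in
set_option synthInstance.maxSize 2000 in
set_option synthInstance.maxHeartbeats 400000 in
set_option maxHeartbeats 4000000 in
lemma five_nat : ∀ a0 a1 : Fin 3, okf a0 a1 → ∀ a2, okf a1 a2 → ∀ a3, okf a2 a3 → ∀ a4, okf a3 a4 →
    okf a4 a0 → ∀ s0 s1, okn s0 a1 s1 → ∀ s2, okn s1 a2 s2 → ∀ s3, okn s2 a3 s3 → ∀ s4, okn s3 a4 s4 →
    okn s4 a0 s0 → v5 a0 s0 a1 + v5 a1 s1 a2 + v5 a2 s2 a3 + v5 a3 s3 a4 + v5 a4 s4 a0 ≤ 60 := by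
  decide +kernel

set_option maxRecDepth 100000 in
set_option synthInstance.maxSize 2000 in
set_option synthInstance.maxHeartbeats 400000 in
set_option maxHeartbeats 4000000 in
lemma four_int : ∀ a0 a1 : Fin 3, okf a0 a1 → ∀ a2, okf a1 a2 → ∀ a3, okf a2 a3 →
    okf a3 a0 → ∀ s0, s0 ≠ 0 → ∀ s1, s1 ≠ 0 → (a1 = 0 → ¬ (s0 = 1 ∧ s1 = 1)) →
    ∀ s2, s2 ≠ 0 → (a2 = 0 → ¬ (s1 = 1 ∧ s2 = 1)) →
    ∀ s3, s3 ≠ 0 → (a3 = 0 → ¬ (s2 = 1 ∧ s3 = 1)) → (a0 = 0 → ¬ (s3 = 1 ∧ s0 = 1)) →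
    (w0 1 a0 a1 + tr 1 s0 a0 a1) + (w0 1 a1 a2 + tr 1 s1 a1 a2) + (w0 1 a2 a3 + tr 1 s2 a2 a3)
     + (w0 1 a3 a0 + tr 1 s3 a3 a0) ≤ 0 := by
  decide +kernel

lemma sum_cyc {X : Type*} [Fintype X] [DecidableEq X] {M : Type*} [AddCommMonoid M] (σ : Equiv.Perm X) (x : X)
    (P : X → Prop) [DecidablePred P] (hP : ∀ y, P y ↔ σ.SameCycle x y) (f : X → M) :
    (∑ y, if P y then f y else 0) = ∑ k ∈ Finset.range (Function.minimalPeriod σ x), f (σ^[k] x) := by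
  rw [← Finset.sum_filter]
  have hp : 0 < Function.minimalPeriod σ x :=
    Function.minimalPeriod_pos_of_mem_periodicPts
      (Function.Injective.mem_periodicPts σ.injective x)
  have : (Finset.univ.filter P) = (Finset.range (Function.minimalPeriod σ x)).image (fun k => σ^[k] x) := by
    ext y
    simp only [Finset.mem_filter, Finset.mem_univ, true_and, Finset.mem_image, Finset.mem_range, hP]
    constructor
    · intro h
      obtain ⟨k, hk⟩ := h.exists_nat_pow_eq
      refine ⟨k % Function.minimalPeriod σ x, Nat.mod_lt _ hp, ?_⟩
      rw [Function.iterate_mod_minimalPeriod_eq, Equiv.Perm.iterate_eq_pow]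
      exact hk
    · rintro ⟨k, -, rfl⟩
      rw [Equiv.Perm.iterate_eq_pow]
      exact ⟨k, rfl⟩
  rw [this, Finset.sum_image]
  intro i hi j hj h
  exact Function.iterate_injOn_Iio_minimalPeriod (by simpa using hi) (by simpa using hj) h
end PartD

set_option linter.unusedSectionVars false
section PartE
open scoped Classical
variable {V : Type*} [Fintype V] {K : SimpleGraph V} (R : RotationSystem K)

lemma dext {d e : K.Dart} (h1 : d.fst = e.fst) (h2 : d.snd = e.snd) : d = e := by
  apply Dart.ext
  exact Prod.ext h1 h2

lemma phi_def (d : K.Dart) : R.φ d = R.σ d.symm := by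
  rw [← phi_symm, Dart.symm_symm]

lemma phi_fst (d : K.Dart) : (R.φ d).fst = d.snd := by
  rw [phi_def, R.tail_fixed]; rfl

lemma same_iff (d e : K.Dart) : e.fst = d.fst ↔ R.σ.SameCycle d e := by
  constructor
  · intro h
    exact R.vertex_cycles _ _ h.symm
  · intro h
    obtain ⟨k, hk⟩ := h.exists_nat_pow_eq
    rw [← hk, ← Equiv.Perm.iterate_eq_pow]
    clear hk h
    induction k with
    | zero => rfl
    | succ k ih => rw [Function.iterate_succ_apply', R.tail_fixed, ih]

lemma dart_count (v : V) : (∑ d : K.Dart, if d.fst = v then 1 else 0) = vdeg K v := by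
  rw [← Finset.sum_filter, ← Finset.card_eq_sum_ones]
  have h := K.dart_fst_fiber_card_eq_degree v
  unfold vdeg
  rw [Nat.card_eq_fintype_card, card_neighborSet_eq_degree]
  convert h

lemma period (d : K.Dart) : Function.minimalPeriod R.σ d = vdeg K d.fst := by
  have := sum_cyc R.σ d (fun e => e.fst = d.fst) (fun e => same_iff R d e) (fun _ => 1)
  rw [dart_count] at this
  simpa using this.symm

lemma per_le (d : K.Dart) (k : ℕ) (hk : 0 < k) (h : R.σ^[k] d = d) : vdeg K d.fst ≤ k := by
  rw [← period R]
  exact Function.IsPeriodicPt.minimalPeriod_le hk h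

/-- face code -/
noncomputable def fcd (d : K.Dart) : Fin 3 :=
  if R.φ (R.φ (R.φ d)) = d then 0 else if R.φ (R.φ (R.φ (R.φ d))) = d then 1 else 2

/-- degree code -/
noncomputable def dcd (K : SimpleGraph V) (v : V) : Fin 3 :=
  if vdeg K v = 3 then 0 else if vdeg K v = 4 then 1 else 2

lemma fcd_phi (d : K.Dart) : fcd R (R.φ d) = fcd R d := by
  simp [fcd, EmbeddingLike.apply_eq_iff_eq]

lemma fcd_sigma (d : K.Dart) : fcd R (R.σ d) = fcd R d.symm := by
  rw [← phi_symm, fcd_phi]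

/-- reduced graph -/
structure Conf (K : SimpleGraph V) : Prop where
  deg3 : ∀ x y, K.Adj x y → 3 ≤ vdeg K x
  deg5 : ∀ x, vdeg K x ≤ 5
  r1 : ∀ x y, K.Adj x y → vdeg K x = 3 → vdeg K y = 5
  r2 : ∀ x1 y1 x2 y2, K.Adj x1 y1 → K.Adj y1 x2 → K.Adj x2 y2 → K.Adj y2 x1 → x1 ≠ x2 → y1 ≠ y2 →
    ¬ (vdeg K x1 = 3 ∧ vdeg K x2 = 3)
  r3 : ∀ a b c, K.Adj a b → K.Adj b c → K.Adj c a → ¬ (vdeg K a = 4 ∧ vdeg K b = 4 ∧ vdeg K c = 4)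
  nd : ¬ ContainsCopy diamondGraph K
  nh : ¬ ContainsCopy houseGraph K

variable (hK : Conf K)
include hK

lemma sig_ne (d : K.Dart) : R.σ d ≠ d := fun h => by
  have := per_le R d 1 (by norm_num) h
  have := hK.deg3 _ _ d.adj
  omega

lemma sig2_ne (d : K.Dart) : R.σ (R.σ d) ≠ d := fun h => by
  have := per_le R d 2 (by norm_num) h
  have := hK.deg3 _ _ d.adj
  omega

lemma phi_ne_symm (d : K.Dart) : (R.φ d).snd ≠ d.fst := fun h => by
  apply sig_ne R hK d.symm
  rw [← phi_def]
  exact dext (phi_fst R d) h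

lemma phi2_ne (d : K.Dart) : R.φ (R.φ d) ≠ d := fun h => by
  apply phi_ne_symm R hK d
  rw [← phi_fst, h]

lemma phi1_ne (d : K.Dart) : R.φ d ≠ d := fun h => by
  have := phi_fst R d
  rw [h] at this
  exact d.adj.ne this

omit hK in
lemma diamond_of {x y z w : V} (h1 : K.Adj x y) (h2 : K.Adj x z) (h3 : K.Adj x w) (h4 : K.Adj y z)
    (h5 : K.Adj y w) (h : z ≠ w) : ContainsCopy diamondGraph K := by
  refine ⟨![x, y, z, w], ?_, ?_⟩
  · have := h1.ne
    have := h2.ne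
    have := h3.ne
    have := h4.ne
    have := h5.ne
    intro i j
    fin_cases i <;> fin_cases j <;> simp <;> grind
  · have := h1.symm
    have := h2.symm
    have := h3.symm
    have := h4.symm
    have := h5.symm
    intro i j
    simp only [diamondGraph, fromEdgeSet_adj]
    fin_cases i <;> fin_cases j <;> simp <;> assumption

omit hK in
lemma house_of {z x y w v : V} (h1 : K.Adj z x) (h2 : K.Adj x w) (h3 : K.Adj w v) (h4 : K.Adj v y)
    (h5 : K.Adj y z) (h6 : K.Adj x y) (n1 : z ≠ w) (n2 : z ≠ v) (n3 : x ≠ v) (n4 : y ≠ w) :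
    ContainsCopy houseGraph K := by
  refine ⟨![z, x, w, v, y], ?_, ?_⟩
  · have := h1.ne
    have := h2.ne
    have := h3.ne
    have := h4.ne
    have := h5.ne
    have := h6.ne
    intro i j
    fin_cases i <;> fin_cases j <;> simp <;> grind
  · have := h1.symm
    have := h2.symm
    have := h3.symm
    have := h4.symm
    have := h5.symm
    have := h6.symm
    intro i j
    simp only [houseGraph, fromEdgeSet_adj]
    fin_cases i <;> fin_cases j <;> simp <;> assumption

omit hK in
lemma tri_of {d : K.Dart} (h : fcd R d = 0) : R.φ (R.φ (R.φ d)) = d := by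
  unfold fcd at h
  split_ifs at h <;> first | assumption | simp at h

omit hK in
lemma quad_of {d : K.Dart} (h : fcd R d = 1) : R.φ (R.φ (R.φ (R.φ d))) = d := by
  unfold fcd at h
  split_ifs at h <;> first | assumption | simp at h

lemma tri_symm (e : K.Dart) (h : fcd R e = 0) : fcd R e.symm = 2 := by
  have h3 := tri_of R h
  set f := R.φ e with hf
  set g := R.φ f with hg
  have a1 : f.fst = e.snd := phi_fst R e
  have a2 : g.fst = f.snd := phi_fst R f
  have a3 : e.fst = g.snd := by rw [← phi_fst R g, h3]
  set e' := R.φ e.symm with he'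
  have b1 : e'.fst = e.fst := phi_fst R e.symm
  set f' := R.φ e' with hf'
  have b2 : f'.fst = e'.snd := phi_fst R e'
  have sg : e = R.σ g.symm := by rw [← phi_def, h3]
  have se : f = R.σ e.symm := by rw [← phi_def]
  have sf : g = R.σ f.symm := by rw [← phi_def]
  have se' : e' = R.σ e := by rw [he', phi_symm]
  have adjyz : K.Adj e.snd f.snd := by rw [← a1]; exact f.adj
  have adjzx : K.Adj f.snd e.fst := by rw [a3, ← a2]; exact g.adj
  unfold fcd
  rw [← he', ← hf']
  rw [if_neg, if_neg]
  · -- four-face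
    intro h4
    set g' := R.φ f' with hg'
    have b3 : g'.fst = f'.snd := phi_fst R f'
    have b4 : e.snd = g'.snd := by
      have := phi_fst R g'
      rw [h4] at this
      exact this
    apply hK.nh
    refine house_of (z := f.snd) (x := e.fst) (y := e.snd) (w := e'.snd) (v := f'.snd)
      adjzx ?_ ?_ ?_ adjyz.symm.symm e.adj ?_ ?_ ?_ ?_
    · rw [← b1]; exact e'.adj
    · rw [← b2]; exact f'.adj
    · rw [← b3, b4]; exact g'.adj
    · intro hzw
      apply sig2_ne R hK e
      rw [← se']
      have : e' = g.symm := dext (b1.trans a3) (by rw [← hzw, ← a2]; rfl)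
      rw [this, ← sg]
    · intro hzv
      apply sig2_ne R hK e.symm
      rw [← se]
      have : g' = f.symm := dext (by rw [b3, ← hzv]; rfl) (by rw [← b4, ← a1]; rfl)
      rw [← h4, this, phi_symm]
    · intro hh
      apply phi_ne_symm R hK e'
      rw [← hf', ← hh, b1]
    · intro hh
      exact phi_ne_symm R hK e.symm hh.symm
  · intro h4
    have b4 : e.snd = f'.snd := by
      have := phi_fst R f'
      rw [h4] at this
      exact this
    apply hK.nd
    refine diamond_of (x := e.fst) (y := e.snd) (z := f.snd) (w := e'.snd) e.adj adjzx.symm ?_ adjyz ?_ ?_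
    · rw [← b1]; exact e'.adj
    · rw [← b2, b4]; exact f'.adj.symm
    · intro hzw
      apply sig2_ne R hK e
      rw [← se']
      have : e' = g.symm := dext (b1.trans a3) (by rw [← hzw, ← a2]; rfl)
      rw [this, ← sg]

lemma okf_dart (d : K.Dart) : okf (fcd R d) (fcd R (R.σ d)) := by
  rw [fcd_sigma]
  exact ⟨tri_symm R hK d, fun h => by simpa using tri_symm R hK d.symm h⟩

omit hK in
lemma tri_adj (d : K.Dart) (h : fcd R (R.σ d) = 0) : K.Adj (R.σ d).snd d.snd := by
  rw [fcd_sigma] at h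
  have h3 := tri_of R h
  rw [phi_symm] at h3
  have a2 := phi_fst R (R.σ d)
  have a3 := phi_fst R (R.φ (R.σ d))
  rw [h3] at a3
  have := (R.φ (R.σ d)).adj
  rw [a2, ← a3] at this
  exact this

lemma dcd0 {v : V} : dcd K v = 0 ↔ vdeg K v = 3 := by
  unfold dcd; split_ifs <;> simp [*]

lemma dcd1 {v : V} : dcd K v = 1 ↔ vdeg K v = 4 := by
  unfold dcd; split_ifs <;> simp [*]

lemma dcd2 {v w : V} (h : K.Adj v w) : dcd K v = 2 ↔ vdeg K v = 5 := by
  have := hK.deg3 _ _ h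
  have := hK.deg5 v
  unfold dcd; split_ifs <;> simp <;> omega

lemma okn_dart (d : K.Dart) : okn (dcd K d.snd) (fcd R (R.σ d)) (dcd K (R.σ d).snd) := by
  refine ⟨fun h => ?_, fun h => ?_⟩
  · have ha := tri_adj R d h
    constructor
    · intro h0
      rw [dcd2 hK ha]
      exact hK.r1 _ _ ha.symm ((dcd0 hK).1 h0)
    · intro h0
      rw [dcd2 hK ha.symm]
      exact hK.r1 _ _ ha ((dcd0 hK).1 h0)
  · rw [dcd0 hK, dcd0 hK]
    rw [fcd_sigma] at h
    have h4 := quad_of R h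
    rw [phi_symm] at h4
    set f := R.σ d with hf
    set g := R.φ f with hg
    set k := R.φ g with hk
    have a1 : f.fst = d.fst := R.tail_fixed d
    have a2 : g.fst = f.snd := phi_fst R f
    have a3 : k.fst = g.snd := phi_fst R g
    have a4 : d.snd = k.snd := by
      have := phi_fst R k
      rw [h4] at this
      exact this
    refine hK.r2 d.snd d.fst f.snd g.snd d.adj.symm ?_ ?_ ?_ ?_ ?_
    · rw [← a1]; exact f.adj
    · rw [← a2]; exact g.adj
    · rw [← a3, a4]; exact k.adj
    · intro hh
      exact sig_ne R hK d (dext a1 hh.symm)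
    · intro hh
      apply phi_ne_symm R hK f
      rw [← hg, ← hh, a1]

/-- charge after transfer -/
noncomputable def chg (d : K.Dart) : ℤ :=
  w0 (dcd K d.fst) (fcd R d) (fcd R d.symm) + tr (dcd K d.fst) (dcd K d.snd) (fcd R d) (fcd R d.symm)

lemma vsum (v : V) : (∑ d : K.Dart, if d.fst = v then chg R d else 0) ≤ 0 := by
  by_cases hv : ∃ d : K.Dart, d.fst = v
  swap
  · push Not at hv
    rw [Finset.sum_eq_zero]
    intro d _
    rw [if_neg (hv d)]
  obtain ⟨d, rfl⟩ := hv
  rw [sum_cyc R.σ d (fun e => e.fst = d.fst) (fun e => same_iff R d e)]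
  have hper := Function.iterate_minimalPeriod (f := R.σ) (x := d)
  rw [period R] at hper ⊢
  have h3 := hK.deg3 _ _ d.adj
  have h5 := hK.deg5 d.fst
  have hch : ∀ e : K.Dart, e.fst = d.fst → chg R e = w0 (dcd K d.fst) (fcd R e) (fcd R (R.σ e)) +
      tr (dcd K d.fst) (dcd K e.snd) (fcd R e) (fcd R (R.σ e)) := by
    intro e he
    rw [chg, fcd_sigma, he]
  have t0 : d.fst = d.fst := rfl
  have t1 : (R.σ d).fst = d.fst := R.tail_fixed _
  have t2 : (R.σ (R.σ d)).fst = d.fst := (R.tail_fixed _).trans t1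
  have t3 : (R.σ (R.σ (R.σ d))).fst = d.fst := (R.tail_fixed _).trans t2
  have t4 : (R.σ (R.σ (R.σ (R.σ d)))).fst = d.fst := (R.tail_fixed _).trans t3
  have hn := okn_dart R hK
  have hf := okf_dart R hK
  obtain h | h | h : vdeg K d.fst = 3 ∨ vdeg K d.fst = 4 ∨ vdeg K d.fst = 5 := by omega
  · have hp : dcd K d.fst = 0 := (dcd0 hK).2 h
    have : ∀ e : K.Dart, e.fst = d.fst → chg R e = 0 := by
      intro e he
      rw [hch e he, hp]
      simp [tr]
    rw [h]
    simp [Finset.sum_range_succ, this _ t1, this _ t2, this _ t0]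
  · have hp : dcd K d.fst = 1 := (dcd1 hK).2 h
    rw [hp] at hch
    rw [h] at hper ⊢
    simp only [Finset.sum_range_succ, Finset.sum_range_zero, Function.iterate_succ_apply',
      Function.iterate_zero, id, zero_add] at hper ⊢
    rw [hch _ t0, hch _ t1, hch _ t2, hch _ t3, hper]
    have hs : ∀ e : K.Dart, e.fst = d.fst → dcd K e.snd ≠ 0 := by
      intro e he h0
      have := hK.r1 _ _ e.adj.symm ((dcd0 hK).1 h0)
      rw [he] at this
      omega
    have ht : ∀ e : K.Dart, e.fst = d.fst → fcd R (R.σ e) = 0 →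
        ¬ (dcd K e.snd = 1 ∧ dcd K (R.σ e).snd = 1) := by
      intro e he h0
      rw [dcd1 hK, dcd1 hK]
      intro hh
      have a1 := tri_adj R e h0
      have a2 := (R.σ e).adj
      rw [R.tail_fixed] at a2
      exact hK.r3 _ _ _ a2 a1 e.adj.symm ⟨by rw [he, h], hh.2, hh.1⟩
    have q1 := hf (R.σ (R.σ (R.σ d)))
    have q2 := ht _ t3
    rw [hper] at q1 q2
    exact four_int _ _ (hf _) _ (hf _) _ (hf _) q1 _ (hs _ t0) _ (hs _ t1) (ht _ t0) _ (hs _ t2)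
      (ht _ t1) _ (hs _ t3) (ht _ t2) q2
  · have hp : dcd K d.fst = 2 := (dcd2 hK d.adj).2 h
    rw [hp] at hch
    rw [h] at hper ⊢
    simp only [Finset.sum_range_succ, Finset.sum_range_zero, Function.iterate_succ_apply',
      Function.iterate_zero, id, zero_add] at hper ⊢
    rw [hch _ t0, hch _ t1, hch _ t2, hch _ t3, hch _ t4, hper]
    have q1 := hf (R.σ (R.σ (R.σ (R.σ d))))
    have q2 := hn (R.σ (R.σ (R.σ (R.σ d))))
    rw [hper] at q1 q2
    have := five_nat _ _ (hf _) _ (hf _) _ (hf _) _ (hf _) q1 _ _ (hn _) _ (hn _) _ (hn _) _ (hn _) q2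
    have k0 := v5_le (fcd R d) (dcd K d.snd) _ (hf _)
    have k1 := v5_le (fcd R (R.σ d)) (dcd K (R.σ d).snd) _ (hf _)
    have k2 := v5_le (fcd R (R.σ (R.σ d))) (dcd K (R.σ (R.σ d)).snd) _ (hf _)
    have k3 := v5_le (fcd R (R.σ (R.σ (R.σ d)))) (dcd K (R.σ (R.σ (R.σ d))).snd) _ (hf _)
    have k4 := v5_le _ (dcd K (R.σ (R.σ (R.σ (R.σ d)))).snd) _ q1
    zify at this
    linarith

lemma total_le : (∑ d : K.Dart, w0 (dcd K d.fst) (fcd R d) (fcd R d.symm)) ≤ 0 := by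
  have h1 : (∑ d : K.Dart, chg R d) ≤ 0 := by
    have : (∑ d : K.Dart, chg R d) = ∑ v : V, ∑ d : K.Dart, if d.fst = v then chg R d else 0 := by
      rw [Finset.sum_comm]
      simp
    rw [this]
    exact Finset.sum_nonpos fun v _ => vsum R hK v
  have h2 : (∑ d : K.Dart, tr (dcd K d.fst) (dcd K d.snd) (fcd R d) (fcd R d.symm)) = 0 := by
    have e1 := Equiv.sum_comp (dartRev K) (fun d : K.Dart => tr (dcd K d.fst) (dcd K d.snd) (fcd R d) (fcd R d.symm))
    have e2 : ∀ d : K.Dart, tr (dcd K d.fst) (dcd K d.snd) (fcd R d) (fcd R d.symm) =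
        - tr (dcd K (dartRev K d).fst) (dcd K (dartRev K d).snd) (fcd R (dartRev K d)) (fcd R (dartRev K d).symm) := by
      intro d
      have : dartRev K d = d.symm := rfl
      rw [this, Dart.symm_symm]
      apply tr_anti
      rintro ⟨p, q⟩
      have := hK.r1 _ _ d.adj ((dcd0 hK).1 p)
      have := (dcd0 hK).1 q
      omega
    rw [← e1]
    rw [Finset.sum_congr rfl fun d _ => e2 d, Finset.sum_neg_distrib] at e1
    linarith
  simp only [chg, Finset.sum_add_distrib] at h1
  linarith

lemma face_sum (F : R.Faces) : 60 ≤ ∑ d : K.Dart, if fc R d = F then wt (fcd R d) else 0 := by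
  induction F using Quotient.inductionOn with
  | _ d =>
  rw [sum_cyc R.φ d _ (fun e => ?_)]
  swap
  · change Quotient.mk R.faceSetoid e = Quotient.mk R.faceSetoid d ↔ _
    rw [Quotient.eq]
    exact ⟨fun h => Equiv.Perm.SameCycle.symm h, fun h => Equiv.Perm.SameCycle.symm h⟩
  have hc : ∀ k, fcd R (R.φ^[k] d) = fcd R d := by
    intro k
    induction k with
    | zero => rfl
    | succ k ih => rw [Function.iterate_succ_apply', fcd_phi, ih]
  simp only [hc, Finset.sum_const, Finset.card_range]
  have hper := Function.iterate_minimalPeriod (f := R.φ) (x := d)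
  have hp : 0 < Function.minimalPeriod R.φ d :=
    Function.minimalPeriod_pos_of_mem_periodicPts
      (Function.Injective.mem_periodicPts R.φ.injective d)
  set p := Function.minimalPeriod R.φ d with hpd
  have p1 : p ≠ 1 := fun h => phi1_ne R hK d (by rw [h] at hper; exact hper)
  have p2 : p ≠ 2 := fun h => phi2_ne R hK d (by rw [h] at hper; exact hper)
  unfold fcd
  split_ifs with q1 q2
  · simp [wt]; omega
  · have : p ≠ 3 := fun h => q1 (by rw [h] at hper; exact hper)
    simp [wt]; omega
  · have : p ≠ 3 := fun h => q1 (by rw [h] at hper; exact hper)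
    have : p ≠ 4 := fun h => q2 (by rw [h] at hper; exact hper)
    simp [wt]; omega

lemma no_conf (hR : PP R) (d0 : K.Dart) : False := by
  have h1 := total_le R hK
  have h2 := euler_of_PP R hR
  -- components
  have h3 : Fintype.card {v : V // vdeg K v = 0} + 1 ≤ Nat.card K.ConnectedComponent := by
    rw [← Fintype.card_option, Nat.card_eq_fintype_card]
    refine Fintype.card_le_of_injective
      (fun o : Option {v : V // vdeg K v = 0} => o.elim (K.connectedComponentMk d0.fst)
        (fun v => K.connectedComponentMk v.1)) ?_
    have iso : ∀ v w : V, vdeg K v = 0 → K.Reachable v w → v = w := by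
      intro v w hv h
      obtain ⟨p⟩ := h
      cases p with
      | nil => rfl
      | cons h _ =>
        have := hK.deg3 _ _ h
        omega
    have hd0 := hK.deg3 _ _ d0.adj
    rintro (_ | ⟨v, hv⟩) (_ | ⟨w, hw⟩) h
    · rfl
    · have h' : K.Reachable d0.fst w := ConnectedComponent.exact h
      have := iso _ _ hw h'.symm
      rw [this] at hw
      omega
    · have h' : K.Reachable v d0.fst := ConnectedComponent.exact h
      have := iso _ _ hv h'
      rw [this] at hv
      omega
    · have h' : K.Reachable v w := ConnectedComponent.exact h
      have := iso _ _ hv h'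
      subst this
      rfl
  -- faces
  have h4 : (60 : ℤ) * R.numFaces ≤ ∑ d : K.Dart, wt (fcd R d) := by
    have : (∑ d : K.Dart, wt (fcd R d)) = ∑ F : R.Faces, ∑ d : K.Dart, if fc R d = F then wt (fcd R d) else 0 := by
      rw [Finset.sum_comm]
      simp
    rw [this, RotationSystem.numFaces, Nat.card_eq_fintype_card]
    have := Finset.card_nsmul_le_sum (Finset.univ : Finset R.Faces) _ 60 (fun F _ => face_sum R hK F)
    simpa [mul_comm] using this
  have h5 : (∑ d : K.Dart, wt (fcd R d.symm)) = ∑ d : K.Dart, wt (fcd R d) :=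
    Equiv.sum_comp (dartRev K) (fun d : K.Dart => wt (fcd R d))
  -- vertices
  have h6 : (∑ d : K.Dart, wt (dcd K d.fst)) = 60 * (Fintype.card V - Fintype.card {v : V // vdeg K v = 0} : ℤ) := by
    have e1 : (∑ d : K.Dart, wt (dcd K d.fst)) = ∑ v : V, ∑ d : K.Dart, if d.fst = v then wt (dcd K d.fst) else 0 := by
      rw [Finset.sum_comm]
      simp
    have e2 : ∀ v : V, (∑ d : K.Dart, if d.fst = v then wt (dcd K d.fst) else 0)
        = 60 - (if vdeg K v = 0 then 60 else 0) := by
      intro v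
      have e3 : (∑ d : K.Dart, if d.fst = v then wt (dcd K d.fst) else 0) =
          wt (dcd K v) * ((∑ d : K.Dart, if d.fst = v then 1 else 0 : ℕ) : ℤ) := by
        push_cast
        rw [Finset.mul_sum]
        refine Finset.sum_congr rfl fun d _ => ?_
        by_cases h : d.fst = v <;> simp [h]
      rw [e3, dart_count]
      by_cases h0 : vdeg K v = 0
      · simp [h0]
      · have : ∃ w, K.Adj v w := by
          by_contra hh
          push Not at hh
          apply h0
          unfold vdeg
          rw [Nat.card_eq_zero]
          left
          exact ⟨fun x => hh _ x.2⟩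
        obtain ⟨w, hw⟩ := this
        have a1 := hK.deg3 _ _ hw
        have a2 := hK.deg5 v
        obtain h | h | h : vdeg K v = 3 ∨ vdeg K v = 4 ∨ vdeg K v = 5 := by omega
        all_goals simp [h, dcd, wt]
    rw [e1, Finset.sum_congr rfl fun v _ => e2 v, Finset.sum_sub_distrib, ← Finset.sum_filter,
      Fintype.card_subtype]
    simp
    ring
  have h7 : (Fintype.card K.Dart : ℤ) = 2 * Nat.card K.edgeSet := by
    have := K.dart_card_eq_twice_card_edges
    rw [Nat.card_eq_fintype_card, ← edgeFinset_card]
    exact_mod_cast this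
  simp only [w0, Finset.sum_add_distrib, Finset.sum_sub_distrib, ← Finset.mul_sum, h5, h6] at h1
  simp only [Finset.sum_const, Finset.card_univ, nsmul_eq_mul, h7] at h1
  generalize Fintype.card {v : V // vdeg K v = 0} = n at *
  omega
end PartE

set_option linter.unusedSectionVars false
section PartF
open scoped Classical
variable {V : Type*} [Fintype V]

lemma vdeg_mono {G G' : SimpleGraph V} (h : G' ≤ G) (v : V) : vdeg G' v ≤ vdeg G v :=
  Nat.card_mono (Set.toFinite _) (fun _ hw => h hw)

lemma copy_mono {α W : Type*} {A : SimpleGraph α} {G : SimpleGraph V} {G' : SimpleGraph W}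
    (f : W → V) (hf : Function.Injective f) (hh : ∀ a b, G'.Adj a b → G.Adj (f a) (f b))
    (h : ContainsCopy A G') : ContainsCopy A G := by
  obtain ⟨g, h1, h2⟩ := h
  exact ⟨f ∘ g, hf.comp h1, fun _ _ hab => hh _ _ (h2 hab)⟩

lemma del_card (G : SimpleGraph V) (D : Set (Sym2 V)) {e : Sym2 V} (he : e ∈ G.edgeSet) (hD : e ∈ D) :
    Nat.card (G.deleteEdges D).edgeSet < Nat.card G.edgeSet := by
  rw [edgeSet_deleteEdges]
  exact Set.ncard_lt_ncard ⟨Set.sdiff_subset, fun h => (h he).2 hD⟩ (Set.toFinite _)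

theorem thmP (n : ℕ) : ∀ K : SimpleGraph V, Nat.card K.edgeSet = n → Pl K → (∀ v, vdeg K v ≤ 5) →
    ¬ ContainsCopy diamondGraph K → ¬ ContainsCopy houseGraph K → TotallyColorable K 7 := by
  induction n using Nat.strong_induction_on with
  | _ n ih =>
  intro K hn hPl h5 hd hh
  by_contra hTC
  have sub : ∀ (D : Set (Sym2 V)) (e : Sym2 V), e ∈ K.edgeSet → e ∈ D →
      TotallyColorable (K.deleteEdges D) 7 := by
    intro D e he heD
    have hle : K.deleteEdges D ≤ K := deleteEdges_le D
    exact ih _ (hn ▸ del_card K D he heD) _ rfl (Pl_mono hle hPl)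
      (fun v => (vdeg_mono hle v).trans (h5 v))
      (fun h => hd (copy_mono id Function.injective_id (fun _ _ h => hle h) h))
      (fun h => hh (copy_mono id Function.injective_id (fun _ _ h => hle h) h))
  have hr1 : ∀ x y, K.Adj x y → vdeg K x ≤ 3 → 8 ≤ vdeg K x + vdeg K y := by
    intro x y hxy hx
    by_contra hlt
    exact hTC (red1 hxy hx (by omega) (sub _ s(x, y) hxy rfl))
  have r1 : ∀ x y, K.Adj x y → vdeg K x = 3 → vdeg K y = 5 := by
    intro x y hxy hx
    have := hr1 x y hxy hx.le
    have := h5 y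
    omega
  have hC : Conf K := by
    refine ⟨?_, h5, r1, ?_, ?_, hd, hh⟩
    · intro x y hxy
      by_contra hlt
      have := hr1 x y hxy (by omega)
      have := h5 y
      omega
    · rintro x1 y1 x2 y2 a1 a2 a3 a4 nx ny ⟨d1, d2⟩
      refine hTC (red2 a1 a2 a3 a4 nx ny ?_ d1.le d2.le (h5 _) (h5 _) (sub _ s(x1, y1) a1 (Or.inl rfl)))
      intro h
      have := r1 _ _ h d1
      omega
    · rintro a b c a1 a2 a3 ⟨d1, d2, d3⟩
      exact hTC (red3 a1 a2 a3 d1.le d2.le d3.le (sub _ s(b, c) a2 (Or.inl rfl)))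
  by_cases hdart : Nonempty K.Dart
  · obtain ⟨d0⟩ := hdart
    obtain ⟨R, hR⟩ := hPl
    exact no_conf R hC hR d0
  · apply hTC
    have hno : ∀ a b, ¬ K.Adj a b := fun a b h => hdart ⟨⟨(a, b), h⟩⟩
    refine ⟨fun _ => 0, fun _ => 0, fun a b h => absurd h (hno a b), ?_, fun a b h => absurd h (hno a b)⟩
    intro e he
    induction e using Sym2.ind with
    | _ a b => exact absurd he (hno a b)

lemma map_ne {W : Type*} {f : W → V} (hf : Function.Injective f) {l m : List (Sym2 W)}
    (h : {e | e ∈ l} ≠ {e | e ∈ m}) :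
    {e | e ∈ l.map (Sym2.map f)} ≠ {e | e ∈ m.map (Sym2.map f)} := by
  have : ∀ l : List (Sym2 W), {e | e ∈ l.map (Sym2.map f)} = Sym2.map f '' {e | e ∈ l} := by
    intro l
    ext e
    simp
  rw [this, this]
  intro hh
  exact h ((Sym2.map.injective hf).image_injective hh)

lemma two_map {W : Type*} {G : SimpleGraph V} {K : SimpleGraph W} (f : K →g G)
    (hf : Function.Injective f) (i : W) (h : TwoAdjacentFourCyclesAt K i) :
    TwoAdjacentFourCyclesAt G (f i) := by
  obtain ⟨c1, c2, h1, h2, h3, h4, h5, e, h6, h7⟩ := h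
  refine ⟨c1.map f, c2.map f, h1.map hf, h2.map hf, by simpa using h3, by simpa using h4, ?_,
    e.map f, ?_, ?_⟩
  · rw [Walk.edges_map, Walk.edges_map]
    exact map_ne hf h5
  · rw [Walk.edges_map]
    exact List.mem_map_of_mem h6
  · rw [Walk.edges_map]
    exact List.mem_map_of_mem h7

lemma three_map {W : Type*} {G : SimpleGraph V} {K : SimpleGraph W} (f : K →g G)
    (hf : Function.Injective f) (i : W) (p q l : ℕ) (h : ThreeCyclesAt K i p q l) :
    ThreeCyclesAt G (f i) p q l := by
  obtain ⟨c1, c2, c3, h1, h2, h3, h4, h5, h6, h7, h8, h9⟩ := h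
  refine ⟨c1.map f, c2.map f, c3.map f, h1.map hf, h2.map hf, h3.map hf, by simpa using h4,
    by simpa using h5, by simpa using h6, ?_, ?_, ?_⟩
  · rw [Walk.edges_map, Walk.edges_map]
    exact map_ne hf h7
  · rw [Walk.edges_map, Walk.edges_map]
    exact map_ne hf h8
  · rw [Walk.edges_map, Walk.edges_map]
    exact map_ne hf h9

lemma comap_vdeg {W : Type*} (G : SimpleGraph V) (ι : W ↪ V)
    (hι : ∀ a b, G.Adj a b → a ∈ Set.range ι) (i : W) : vdeg (G.comap ι) i = vdeg G (ι i) := by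
  unfold vdeg
  have : G.neighborSet (ι i) = ι '' ((G.comap ι).neighborSet i) := by
    ext w
    constructor
    · intro h
      obtain ⟨j, rfl⟩ := hι _ _ (SimpleGraph.Adj.symm h)
      exact ⟨j, h, rfl⟩
    · rintro ⟨j, h, rfl⟩
      exact h
  rw [this, Nat.card_image_of_injective ι.injective]

lemma comap_edges {W : Type*} (G : SimpleGraph V) (ι : W ↪ V) :
    Nat.card (G.comap ι).edgeSet ≤ Nat.card G.edgeSet := by
  rw [← Nat.card_image_of_injective (Sym2.map.injective ι.injective) (G.comap ι).edgeSet]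
  refine Nat.card_mono (Set.toFinite _) ?_
  rintro _ ⟨e, he, rfl⟩
  induction e using Sym2.ind with
  | _ a b => exact he

lemma comap_tc {W : Type*} [Nonempty W] (G : SimpleGraph V) (ι : W ↪ V)
    (hι : ∀ a b, G.Adj a b → a ∈ Set.range ι) (h : TotallyColorable (G.comap ι) 7) :
    TotallyColorable G 7 := by
  obtain ⟨cv, ce, h1, h2, h3⟩ := h
  let g := Function.invFun ι
  have hg : ∀ a b, G.Adj a b → ι (g a) = a := fun a b hab => Function.invFun_eq (hι a b hab)
  have ha : ∀ a b, G.Adj a b → (G.comap ι).Adj (g a) (g b) := by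
    intro a b hab
    rw [comap_adj, hg a b hab, hg b a hab.symm]
    exact hab
  have he : ∀ e ∈ G.edgeSet, e.map g ∈ (G.comap ι).edgeSet ∧ (e.map g).map ι = e := by
    intro e he
    induction e using Sym2.ind with
    | _ a b =>
      refine ⟨ha a b he, ?_⟩
      simp only [Sym2.map_mk]
      rw [hg a b he, hg b a (SimpleGraph.Adj.symm he)]
  refine ⟨fun v => cv (g v), fun e => ce (e.map g), fun a b hab => h1 (ha a b hab), ?_,
    fun a b hab => h3 (ha a b hab)⟩
  rintro e1 q1 e2 q2 hne ⟨x, hx1, hx2⟩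
  refine h2 _ (he _ q1).1 _ (he _ q2).1 ?_ ⟨g x, Sym2.mem_map.2 ⟨x, hx1, rfl⟩, Sym2.mem_map.2 ⟨x, hx2, rfl⟩⟩
  intro hh
  apply hne
  rw [← (he _ q1).2, ← (he _ q2).2, hh]

theorem main_aux (H : SimpleGraph V) (hmin : MinimalCounterexample H)
    {u v : V} (huv : H.Adj u v) (hu : vdeg H u ≤ 3) : 8 ≤ vdeg H u + vdeg H v := by
  by_contra hlt
  obtain ⟨⟨⟨R0, hR0⟩, ⟨hmax, -⟩, hd, hh, hgood⟩, hTC, hm⟩ := hmin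
  have hPl : Pl H := ⟨R0, PP_of_planar R0 hR0⟩
  set G := H.deleteEdges {s(u, v)} with hG
  have hle : G ≤ H := deleteEdges_le _
  have hGTC : ¬ TotallyColorable G 7 := fun h => hTC (red1 huv hu (by omega) h)
  have hGd : ¬ ContainsCopy diamondGraph G :=
    fun h => hd (copy_mono id Function.injective_id (fun _ _ h => hle h) h)
  have hGh : ¬ ContainsCopy houseGraph G :=
    fun h => hh (copy_mono id Function.injective_id (fun _ _ h => hle h) h)
  have hGPl := Pl_mono hle hPl
  have hcard : Nat.card G.edgeSet < Nat.card H.edgeSet := del_card H _ (e := s(u, v)) huv rfl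
  by_cases h5 : ∀ x, vdeg G x ≤ 5
  · exact hGTC (thmP _ G rfl hGPl h5 hGd hGh)
  push Not at h5
  obtain ⟨x0, hx0⟩ := h5
  have hmaxG : ∀ x, vdeg G x ≤ 6 := fun x => (vdeg_mono hle x).trans (hmax x)
  let ι : Fin (Fintype.card G.support) ↪ V :=
    (Fintype.equivFin G.support).symm.toEmbedding.trans (Function.Embedding.subtype _)
  have hrange : ∀ a, a ∈ Set.range ι ↔ ∃ b, G.Adj a b := by
    intro a
    constructor
    · rintro ⟨i, rfl⟩
      exact ((Fintype.equivFin G.support).symm i).2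
    · intro h
      exact ⟨Fintype.equivFin G.support ⟨a, h⟩, by simp [ι]⟩
  have hι : ∀ a b, G.Adj a b → a ∈ Set.range ι := fun a b h => (hrange a).2 ⟨b, h⟩
  have hx0' : ∃ b, G.Adj x0 b := by
    by_contra hno
    push Not at hno
    have : vdeg G x0 = 0 := by
      unfold vdeg
      rw [Nat.card_eq_zero]
      exact Or.inl ⟨fun x => hno _ x.2⟩
    omega
  obtain ⟨i0, hi0⟩ := (hrange x0).2 hx0'
  have : Nonempty (Fin (Fintype.card G.support)) := ⟨i0⟩
  have hdeg := comap_vdeg G ι hι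
  let f : G.comap ι →g H := ⟨ι, fun h => hle h⟩
  have hf : Function.Injective f := ι.injective
  have hgoodK : GoodGraph (G.comap ι) := by
    refine ⟨?_, ⟨?_, i0, ?_⟩, ?_, ?_, ?_⟩
    · obtain ⟨R, hR⟩ := Pl_comap ι hι hGPl
      refine ⟨R, ?_⟩
      have := planar_of_PP R (fun i => ?_) hR
      · convert this
      · obtain ⟨b, hb⟩ := (hrange (ι i)).1 ⟨i, rfl⟩
        obtain ⟨j, rfl⟩ := hι _ _ hb.symm
        exact ⟨⟨(i, j), hb⟩, rfl⟩
    · intro i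
      rw [hdeg]
      exact hmaxG _
    · rw [hdeg, hi0]
      have := hmaxG x0
      omega
    · exact fun h => hGd (copy_mono ι ι.injective (fun _ _ h => h) h)
    · exact fun h => hGh (copy_mono ι ι.injective (fun _ _ h => h) h)
    · intro i hi
      have h6 : vdeg H (ι i) = 6 := by
        rw [hdeg] at hi
        have := vdeg_mono hle (ι i)
        have := hmax (ι i)
        omega
      rcases hgood _ h6 with h | h
      · exact Or.inl fun h' => h (two_map f hf i h')
      · exact Or.inr fun p q l hpq h' => h p q l hpq (three_map f hf i p q l h')
  have hfin := hm _ _ hgoodK (fun h => hGTC (comap_tc G ι hι h))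
  have e1 := comap_edges G ι
  have e2 : Fintype.card G.support ≤ Fintype.card V := Fintype.card_subtype_le _
  omega
end PartF


/-- **Lemma 1 (1).** In a minimal counterexample, every edge with an endpoint of degree at
most 3 has degree sum at least 8. -/
theorem minimal_counterexample_degree_sum
    {V : Type*} [Fintype V] (H : SimpleGraph V)
    (hmin : MinimalCounterexample H)
    {u v : V} (huv : H.Adj u v) (hdeg : vdeg H u ≤ 3 ∨ vdeg H v ≤ 3) :
    8 ≤ vdeg H u + vdeg H v := by
  rcases hdeg with h | h
  · exact main_aux H hmin huv h
  · rw [add_comm]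
    exact main_aux H hmin huv.symm h
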